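/- arXiv:1701.08557 — 12 statements merged into one kernel-verified Lean document; each statement's English description precedes it below -/
import Mathlib

section
/- Let $n \geq 1$ and let $A$ and $B$ be nonempty finite subsets of $\mathbb{R}^n$ with $|A| \leq |B|$ such that the affine span of the Minkowski sum $A+B$ is all of $\mathbb{R}^n$. Then $|A+B| \geq n\,|A| + |B| - \frac{n(n+1)}{2}$. -/
open scoped Pointwise

section Ruzsa

variable {K E : Type*} [Field K] [AddCommGroup E] [Module K E]

open Submodule Module

theorem vectorSpan_insert_eq_sup_span_sub {s : Set E} {p : E} (hp : p ∈ s) (a : E) :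
    vectorSpan K (insert a s) = vectorSpan K s ⊔ span K {a - p} := by
  rw [vectorSpan_eq_span_vsub_set_right K (Set.mem_insert_of_mem a hp), Set.image_insert_eq,
    span_insert, sup_comm, vectorSpan_eq_span_vsub_set_right K hp]
  rfl

theorem vectorSpan_eq_sup_span_erase [DecidableEq E] {s : Finset E} {a p : E} (ha : a ∈ s) (hp : p ∈ s.erase a) :
    vectorSpan K (s : Set E) = vectorSpan K (s.erase a : Set E) ⊔ span K {a - p} := by
  rw [← vectorSpan_insert_eq_sup_span_sub (by exact_mod_cast hp), ← Finset.coe_insert,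
    Finset.insert_erase ha]

theorem vectorSpan_add_le (s t : Set E) :
    vectorSpan K (s + t) ≤ vectorSpan K s ⊔ vectorSpan K t := by
  refine span_le.2 ?_
  rintro _ ⟨_, ⟨a, ha, b, hb, rfl⟩, _, ⟨c, hc, d, hd, rfl⟩, rfl⟩
  have : (a + b) -ᵥ (c + d) = (a - c) + (b - d) := by simp only [vsub_eq_sub]; abel
  simp only [this]
  exact add_mem_sup (vsub_mem_vectorSpan K ha hc) (vsub_mem_vectorSpan K hb hd)

variable [LinearOrder E] [IsOrderedAddMonoid E]

/-- The elements of a finite set of positive vectors which are not sums of two elements of the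
set span the whole set. -/
theorem mem_span_filter_not_sum {S : Finset E} (hS : ∀ s ∈ S, 0 < s) {s : E} (hs : s ∈ S) :
    s ∈ span K (↑(S.filter fun t => ∀ x ∈ S, ∀ y ∈ S, x + y ≠ t) : Set E) := by
  refine (S.finite_toSet.wellFoundedOn (r := (· < ·))).induction
    (P := fun s => s ∈ span K (↑(S.filter fun t => ∀ x ∈ S, ∀ y ∈ S, x + y ≠ t) : Set E))
    hs fun t ht ih => ?_
  by_cases h : ∀ x ∈ S, ∀ y ∈ S, x + y ≠ t
  · exact subset_span (by simpa using ⟨ht, h⟩)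
  · push Not at h
    obtain ⟨x, hx, y, hy, rfl⟩ := h
    exact add_mem (ih x hx (lt_add_of_pos_right x (hS y hy)))
      (ih y hy (lt_add_of_pos_left y (hS x hx)))

/-- Deleting the largest element from each summand deletes from the sumset at least one more
element than its dimension. -/
theorem card_erase_max'_add_erase_max' [FiniteDimensional K E] (A B : Finset E)
    (hA : A.Nonempty) (hB : B.Nonempty) :
    ((A.erase (A.max' hA)) + (B.erase (B.max' hB))).card
      + (finrank K ↥(vectorSpan K (A : Set E) ⊔ vectorSpan K (B : Set E)) + 1)
        ≤ (A + B).card := by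
  set a := A.max' hA with ha
  set b := B.max' hB with hb
  have haA : a ∈ A := A.max'_mem hA
  have hbB : b ∈ B := B.max'_mem hB
  set A' := A.erase a
  set B' := B.erase b
  have hltA : ∀ x ∈ A', x < a := fun x hx => A.lt_max'_of_mem_erase_max' hA hx
  have hltB : ∀ x ∈ B', x < b := fun x hx => B.lt_max'_of_mem_erase_max' hB hx
  set S := A'.image (a - ·) ∪ B'.image (b - ·) with hSdef
  have hSA : ∀ x ∈ A', a - x ∈ S := fun x hx =>
    Finset.mem_union_left _ (Finset.mem_image_of_mem _ hx)
  have hSB : ∀ x ∈ B', b - x ∈ S := fun x hx =>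
    Finset.mem_union_right _ (Finset.mem_image_of_mem _ hx)
  have hS : ∀ s ∈ S, 0 < s := by
    intro s hs
    rcases Finset.mem_union.1 hs with h | h
    · obtain ⟨x, hx, rfl⟩ := Finset.mem_image.1 h
      exact sub_pos.2 (hltA x hx)
    · obtain ⟨x, hx, rfl⟩ := Finset.mem_image.1 h
      exact sub_pos.2 (hltB x hx)
  set T := S.filter fun t => ∀ x ∈ S, ∀ y ∈ S, x + y ≠ t with hT
  have hTspan : vectorSpan K (A : Set E) ⊔ vectorSpan K (B : Set E) ≤ span K (T : Set E) := by
    refine sup_le ?_ ?_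
    · rw [vectorSpan_eq_span_vsub_set_left K (p := a) haA, span_le]
      rintro _ ⟨x, hx, rfl⟩
      by_cases hxa : x = a
      · simp [hxa]
      · exact mem_span_filter_not_sum hS (hSA x (Finset.mem_erase.2 ⟨hxa, hx⟩))
    · rw [vectorSpan_eq_span_vsub_set_left K (p := b) hbB, span_le]
      rintro _ ⟨x, hx, rfl⟩
      by_cases hxb : x = b
      · simp [hxb]
      · exact mem_span_filter_not_sum hS (hSB x (Finset.mem_erase.2 ⟨hxb, hx⟩))
  have hTcard : finrank K ↥(vectorSpan K (A : Set E) ⊔ vectorSpan K (B : Set E)) ≤ T.card :=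
    (finrank_mono hTspan).trans (finrank_span_finset_le_card T)
  have h0 : (0 : E) ∉ T := fun h => (hS 0 (Finset.mem_filter.1 h).1).false
  have hN : ((insert 0 T).image (a + b - ·)).card = T.card + 1 := by
    rw [Finset.card_image_of_injective _ sub_right_injective, Finset.card_insert_of_notMem h0]
  have hdisj : Disjoint (A' + B') ((insert 0 T).image (a + b - ·)) := by
    rw [Finset.disjoint_right]
    intro _ hz hz'
    obtain ⟨t, ht, rfl⟩ := Finset.mem_image.1 hz
    obtain ⟨x, hx, y, hy, hxy⟩ := Finset.mem_add.1 hz'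
    have hsum : (a - x) + (b - y) = t := by
      rw [sub_add_sub_comm, hxy, sub_sub_cancel]
    rcases Finset.mem_insert.1 ht with rfl | ht
    · exact (add_pos (hS _ (hSA x hx)) (hS _ (hSB y hy))).ne' hsum
    · exact (Finset.mem_filter.1 ht).2 _ (hSA x hx) _ (hSB y hy) hsum
  have hsub : (A' + B') ∪ (insert 0 T).image (a + b - ·) ⊆ A + B := by
    refine Finset.union_subset
      (Finset.add_subset_add (A.erase_subset a) (B.erase_subset b)) ?_
    intro _ hz
    obtain ⟨t, ht, rfl⟩ := Finset.mem_image.1 hz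
    rcases Finset.mem_insert.1 ht with rfl | ht
    · simpa using Finset.add_mem_add haA hbB
    · rcases Finset.mem_union.1 (Finset.mem_filter.1 ht).1 with h | h
      · obtain ⟨x, hx, rfl⟩ := Finset.mem_image.1 h
        exact Finset.mem_add.2 ⟨x, Finset.mem_of_mem_erase hx, b, hbB, by abel⟩
      · obtain ⟨x, hx, rfl⟩ := Finset.mem_image.1 h
        exact Finset.mem_add.2 ⟨a, haA, x, Finset.mem_of_mem_erase hx, by abel⟩
  have := Finset.card_le_card hsub
  rw [Finset.card_union_of_disjoint hdisj, hN] at this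
  omega

/-- Ruzsa's inequality, with the dimension of `A + B` expressed as that of the sum of the
direction spaces of `A` and `B`. -/
theorem two_mul_finrank_mul_card_add_card_le [FiniteDimensional K E] (A B : Finset E)
    (hA : A.Nonempty) (hAB : A.card ≤ B.card) {d : ℕ}
    (hd : finrank K ↥(vectorSpan K (A : Set E) ⊔ vectorSpan K (B : Set E)) = d) :
    2 * (d * A.card + B.card) ≤ 2 * (A + B).card + d * (d + 1) := by
  induction hN : A.card + B.card using Nat.strong_induction_on generalizing A B d with
  | _ N ih =>
  have hB : B.Nonempty := Finset.card_pos.1 (hA.card_pos.trans_le hAB)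
  rcases Nat.eq_or_lt_of_le hA.card_pos with h1 | h1
  · have h : B.card ≤ (A + B).card := Finset.card_le_card_add_left hA
    have : 2 * d ≤ d * (d + 1) := by
      rcases Nat.eq_zero_or_pos d with rfl | hd0
      · simp
      · nlinarith
    rw [← h1]
    omega
  have hcard := card_erase_max'_add_erase_max' (K := K) A B hA hB
  rw [hd] at hcard
  have haA : A.max' hA ∈ A := A.max'_mem hA
  have hbB : B.max' hB ∈ B := B.max'_mem hB
  have hltB : ∀ x ∈ B.erase (B.max' hB), x < B.max' hB :=
    fun x hx => B.lt_max'_of_mem_erase_max' hB hx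
  have hltA : ∀ x ∈ A.erase (A.max' hA), x < A.max' hA :=
    fun x hx => A.lt_max'_of_mem_erase_max' hA hx
  generalize A.max' hA = a at *
  generalize B.max' hB = b at *
  have hcA : (A.erase a).card + 1 = A.card := Finset.card_erase_add_one haA
  have hcB : (B.erase b).card + 1 = B.card := Finset.card_erase_add_one hbB
  have hA' : (A.erase a).Nonempty := Finset.card_pos.1 (by omega)
  have hB' : (B.erase b).Nonempty := Finset.card_pos.1 (by omega)
  obtain ⟨p, hp⟩ := id hA'
  obtain ⟨q, hq⟩ := id hB'
  have hvA := vectorSpan_eq_sup_span_erase (K := K) haA hp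
  have hvB := vectorSpan_eq_sup_span_erase (K := K) hbB hq
  by_cases hβ : b - q ∈ vectorSpan K (A : Set E) ⊔ vectorSpan K (B.erase b : Set E)
  · have hU : finrank K ↥(vectorSpan K (A : Set E) ⊔ vectorSpan K (B.erase b : Set E)) = d := by
      rw [← hd, hvB, ← sup_assoc, sup_eq_left.2 ((span_singleton_le_iff_mem _ _).2 hβ)]
    rw [hvA, sup_right_comm] at hU
    by_cases hα : a - p ∈ vectorSpan K (A.erase a : Set E) ⊔ vectorSpan K (B.erase b : Set E)
    · rw [sup_eq_left.2 ((span_singleton_le_iff_mem _ _).2 hα)] at hU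
      have := ih _ (by omega) _ _ hA' (by omega) hU rfl
      rw [← hcA, ← hcB]
      nlinarith
    · rw [finrank_sup_span_singleton hα] at hU
      obtain ⟨e, rfl⟩ : ∃ e, d = e + 1 := ⟨_, hU.symm⟩
      have := ih _ (by omega) _ _ hA' (by omega) (Nat.succ.inj hU) rfl
      have hdisj : Disjoint (A.erase a + B.erase b) ({a} + B) := by
        rw [Finset.disjoint_right]
        intro _ hz hz'
        obtain ⟨_, ha', y, hy, rfl⟩ := Finset.mem_add.1 hz
        obtain ⟨x', hx', y', hy', h⟩ := Finset.mem_add.1 hz'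
        rw [Finset.mem_singleton.1 ha'] at h
        by_cases hyb : y = b
        · subst hyb
          exact (add_lt_add (hltA x' hx') (hltB y' hy')).ne h
        · refine hα ?_
          have : a - p = (x' - p) + (y' - y) := by rw [sub_add_sub_comm, h]; abel
          rw [this]
          exact add_mem_sup (vsub_mem_vectorSpan K (by exact_mod_cast hx') (by exact_mod_cast hp))
            (vsub_mem_vectorSpan K (by exact_mod_cast hy')
              (by exact_mod_cast Finset.mem_erase.2 ⟨hyb, hy⟩))
      have hsub : (A.erase a + B.erase b) ∪ ({a} + B) ⊆ A + B :=
        Finset.union_subset (Finset.add_subset_add (A.erase_subset a) (B.erase_subset b))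
          (Finset.add_subset_add_right (Finset.singleton_subset_iff.2 haA))
      have hle := Finset.card_le_card hsub
      rw [Finset.card_union_of_disjoint hdisj, Finset.card_singleton_add] at hle
      rw [← hcA, ← hcB] at hAB ⊢
      nlinarith
  · have hU := finrank_sup_span_singleton hβ
    rw [sup_assoc, ← hvB, hd] at hU
    obtain ⟨e, rfl⟩ : ∃ e, d = e + 1 := ⟨_, hU⟩
    have hU' := (Nat.succ.inj hU).symm
    have hdisj : Disjoint (A + B.erase b) (A + {b}) := by
      rw [Finset.disjoint_right]
      intro _ hz hz'
      obtain ⟨x, hx, _, hb', rfl⟩ := Finset.mem_add.1 hz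
      obtain ⟨x', hx', y', hy', h⟩ := Finset.mem_add.1 hz'
      rw [Finset.mem_singleton.1 hb'] at h
      refine hβ ?_
      have : b - q = (x' - x) + (y' - q) := by rw [sub_add_sub_comm, h]; abel
      rw [this]
      exact add_mem_sup (vsub_mem_vectorSpan K (by exact_mod_cast hx') (by exact_mod_cast hx))
        (vsub_mem_vectorSpan K (by exact_mod_cast hy') (by exact_mod_cast hq))
    have hsub : (A + B.erase b) ∪ (A + {b}) ⊆ A + B :=
      Finset.union_subset (Finset.add_subset_add_left (B.erase_subset b))
        (Finset.add_subset_add_left (Finset.singleton_subset_iff.2 hbB))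
    have hle := Finset.card_le_card hsub
    rw [Finset.card_union_of_disjoint hdisj, Finset.card_add_singleton] at hle
    rcases hAB.lt_or_eq with hlt | heq
    · have := ih _ (by omega) _ _ hA (by omega) hU' rfl
      rw [← hcB]
      nlinarith
    · rw [sup_comm] at hU'
      have := ih _ (by omega) _ _ hB' (by omega) hU' rfl
      rw [add_comm (B.erase b) A, heq] at this
      rw [heq] at hle ⊢
      rw [← hcB] at hle this ⊢
      nlinarith

end Ruzsa

/-- Ruzsa's theorem: for finite sets `A, B ⊆ ℝⁿ` with `|A| ≤ |B|` whose Minkowski sum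
affinely spans `ℝⁿ`, one has `|A+B| ≥ n|A| + |B| - n(n+1)/2`. -/
theorem ruzsa_sumset_lower_bound (n : ℕ) (hn : 1 ≤ n)
    (A B : Finset (Fin n → ℝ)) (hA : A.Nonempty) (hB : B.Nonempty)
    (hAB : A.card ≤ B.card)
    (hspan : affineSpan ℝ ((A + B : Finset (Fin n → ℝ)) : Set (Fin n → ℝ)) = ⊤) :
    (n : ℤ) * A.card + B.card - n * (n + 1) / 2 ≤ ((A + B).card : ℤ) := by
  have htop : vectorSpan ℝ (A : Set (Fin n → ℝ)) ⊔ vectorSpan ℝ (B : Set (Fin n → ℝ)) = ⊤ := by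
    rw [eq_top_iff, ← AffineSubspace.direction_top ℝ (Fin n → ℝ) (Fin n → ℝ), ← hspan,
      direction_affineSpan, Finset.coe_add]
    exact vectorSpan_add_le _ _
  have hd : Module.finrank ℝ
      ↥(vectorSpan ℝ (A : Set (Fin n → ℝ)) ⊔ vectorSpan ℝ (B : Set (Fin n → ℝ))) = n := by
    rw [htop, finrank_top, Module.finrank_fin_fun]
  have key : 2 * (n * A.card + B.card) ≤ 2 * (A + B).card + n * (n + 1) := by
    convert @two_mul_finrank_mul_card_add_card_le ℝ (Fin n → ℝ) _ _ _
      (inferInstance : LinearOrder (Lex (Fin n → ℝ)))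
      (inferInstance : IsOrderedAddMonoid (Lex (Fin n → ℝ))) _ A B hA hAB n hd
    rfl
  zify at key
  omega
end

section
/- Let $n \geq 1$ and let $A$ and $B$ be nonempty finite subsets of $\mathbb{R}^n$ with $|A| \leq |B|$ such that the affine span of the Minkowski sum $A+B$ is all of $\mathbb{R}^n$. Then $|A+B| \geq |B| + \sum_{i=1}^{|A|-1} \min\{n,\ |B|-i\}$. -/
open scoped Pointwise

namespace Ruzsa

open Finset

/-- The value `q + ∑_{i=1}^{p-1} min {n, q - i}`. -/
def bound (n p q : ℕ) : ℕ := q + ∑ i ∈ range (p - 1), min n (q - 1 - i)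

lemma bound_eq_sum_Icc (n p q : ℕ) :
    bound n p q = q + ∑ i ∈ Icc 1 (p - 1), min n (q - i) := by
  rw [bound, range_eq_Ico, ← Ico_add_one_right_eq_Icc, sum_Ico_eq_sum_range,
    sum_Ico_eq_sum_range]
  simp only [Nat.sub_sub, Nat.sub_zero, Nat.add_sub_cancel, zero_add]

lemma bound_succ_succ (n k l : ℕ) :
    bound n (k + 2) (l + 2) = bound n (k + 1) (l + 1) + (1 + min n (l + 1)) := by
  have h : ∀ i, l + 2 - 1 - (i + 1) = l + 1 - 1 - i := fun i => by lia
  simp only [bound, show k + 2 - 1 = k + 1 by lia, show k + 1 - 1 = k by lia, sum_range_succ', h]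
  simp
  lia

lemma bound_le_remove_right {n m : ℕ} (hnm : n ≤ m + 1) (k l : ℕ) :
    bound n (k + 2) (l + 2) ≤ bound m (k + 2) (l + 1) + (k + 2) := by
  have h : ∑ i ∈ range (k + 1), min n (l + 2 - 1 - i) ≤
      ∑ i ∈ range (k + 1), (min m (l + 1 - 1 - i) + 1) := sum_le_sum fun i _ => by lia
  rw [sum_add_distrib] at h
  simp only [bound, show k + 2 - 1 = k + 1 by lia]
  simp only [sum_const, card_range, smul_eq_mul, mul_one] at h
  lia

lemma bound_le_remove_left {n m : ℕ} (hnm : n ≤ m + 1) {k l : ℕ} (hkl : k ≤ l) :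
    bound n (k + 2) (l + 2) ≤ bound m (k + 1) (l + 2) + (l + 2) := by
  have h : ∑ i ∈ range k, min n (l + 2 - 1 - i) ≤
      ∑ i ∈ range k, (min m (l + 2 - 1 - i) + 1) := sum_le_sum fun i _ => by lia
  rw [sum_add_distrib] at h
  simp only [bound, show k + 2 - 1 = k + 1 by lia, show k + 1 - 1 = k by lia, sum_range_succ]
  simp only [sum_const, card_range, smul_eq_mul, mul_one] at h
  lia

lemma sum_min_le {n m : ℕ} (hnm : n ≤ m + 1) {k l : ℕ} (hkl : k ≤ l) :
    ∑ i ∈ range k, min n (l - i) + min n (l + 1) ≤ ∑ i ∈ range k, min m (l - i) + (l + 1) := by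
  induction k generalizing l with
  | zero => simp
  | succ k ih =>
    obtain ⟨l, rfl⟩ : ∃ j, l = j + 1 := ⟨l - 1, by lia⟩
    have := ih (l := l) (by lia)
    simp only [sum_range_succ', Nat.add_sub_add_right, Nat.sub_zero]
    lia

lemma bound_le_remove_both {n m : ℕ} (hnm : n ≤ m + 1) {k l : ℕ} (hkl : k ≤ l) :
    bound n (k + 2) (l + 2) ≤ bound m (k + 1) (l + 1) + (l + 2) := by
  have := sum_min_le hnm hkl
  rw [bound_succ_succ]
  simp only [bound, Nat.add_sub_cancel]
  lia

lemma card_add_card_le_of_disjoint {α : Type*} [DecidableEq α] {S T U : Finset α} (hS : S ⊆ U)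
    (hT : T ⊆ U) (h : ∀ x ∈ T, x ∉ S) : #S + #T ≤ #U := by
  rw [← card_union_of_disjoint (disjoint_right.2 fun {x} => h x)]
  exact card_le_card (union_subset hS hT)

variable {V : Type*} [AddCommGroup V] [Module ℝ V]

section Irreducible

variable [DecidableEq V]

lemma span_le_span_sdiff_add {S : Finset V} {φ : V →ₗ[ℝ] ℝ} (hφ : ∀ s ∈ S, 0 < φ s) :
    Submodule.span ℝ (S : Set V) ≤ Submodule.span ℝ ((S \ (S + S) : Finset V) : Set V) := by
  classical
  rw [Submodule.span_le]
  by_contra hS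
  obtain ⟨s, hs, hmin⟩ := (S.filter fun s =>
      s ∉ Submodule.span ℝ ((S \ (S + S) : Finset V) : Set V)).exists_min_image φ (by
    obtain ⟨s, hs, h⟩ := Set.not_subset.1 hS
    exact ⟨s, mem_filter.2 ⟨hs, h⟩⟩)
  rw [mem_filter] at hs
  by_cases hss : s ∈ S + S
  · obtain ⟨x, hx, y, hy, rfl⟩ := mem_add.1 hss
    have key : ∀ z ∈ S, φ z < φ (x + y) →
        z ∈ Submodule.span ℝ ((S \ (S + S) : Finset V) : Set V) := fun z hz hlt => by
      by_contra h
      exact (hmin z (mem_filter.2 ⟨hz, h⟩)).not_gt hlt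
    have hx0 := hφ x hx
    have hy0 := hφ y hy
    exact hs.2 (add_mem (key x hx (by rw [map_add]; linarith))
      (key y hy (by rw [map_add]; linarith)))
  · exact hs.2 (Submodule.subset_span (mem_coe.2 (mem_sdiff.2 ⟨hs.1, hss⟩)))

lemma finrank_span_le_card_sdiff_add {S : Finset V} {φ : V →ₗ[ℝ] ℝ} (hφ : ∀ s ∈ S, 0 < φ s) :
    Module.finrank ℝ (Submodule.span ℝ (S : Set V)) ≤ #(S \ (S + S)) := by
  have : FiniteDimensional ℝ (Submodule.span ℝ ((S \ (S + S) : Finset V) : Set V)) :=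
    FiniteDimensional.span_finset ℝ _
  exact (Submodule.finrank_mono (span_le_span_sdiff_add hφ)).trans (finrank_span_finset_le_card _)

end Irreducible

lemma vectorSpan_insert_eq_sup (a : V) {s : Set V} {p : V} (hp : p ∈ s) :
    vectorSpan ℝ (insert a s) = vectorSpan ℝ s ⊔ Submodule.span ℝ {a - p} := by
  rw [vectorSpan_eq_span_vsub_set_right ℝ hp,
    vectorSpan_eq_span_vsub_set_right ℝ (Set.mem_insert_of_mem a hp), Set.image_insert_eq,
    Submodule.span_insert, sup_comm, vsub_eq_sub]

lemma sub_mem_vectorSpan {s : Set V} {x y : V} (hx : x ∈ s) (hy : y ∈ s) :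
    x - y ∈ vectorSpan ℝ s :=
  vsub_mem_vectorSpan ℝ hx hy

lemma vectorSpan_add_le (s t : Set V) :
    vectorSpan ℝ (s + t) ≤ vectorSpan ℝ s ⊔ vectorSpan ℝ t := by
  rw [vectorSpan_def, Submodule.span_le]
  rintro _ ⟨_, ⟨x, hx, y, hy, rfl⟩, _, ⟨x', hx', y', hy', rfl⟩, rfl⟩
  have : x + y - (x' + y') = (x - x') + (y - y') := by abel
  rw [SetLike.mem_coe]
  simp only [vsub_eq_sub, this]
  exact Submodule.add_mem_sup (sub_mem_vectorSpan hx hx') (sub_mem_vectorSpan hy hy')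

/-- The space of directions of the sumset `A + B`, for nonempty `A` and `B`. -/
def dir (A B : Finset V) : Submodule ℝ V :=
  vectorSpan ℝ (A : Set V) ⊔ vectorSpan ℝ (B : Set V)

lemma dir_comm (A B : Finset V) : dir A B = dir B A := sup_comm _ _

lemma sub_mem_dir_left {A : Finset V} (B : Finset V) {x y : V} (hx : x ∈ A) (hy : y ∈ A) :
    x - y ∈ dir A B :=
  Submodule.mem_sup_left (sub_mem_vectorSpan (mem_coe.2 hx) (mem_coe.2 hy))

lemma sub_mem_dir_right (A : Finset V) {B : Finset V} {x y : V} (hx : x ∈ B) (hy : y ∈ B) :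
    x - y ∈ dir A B :=
  Submodule.mem_sup_right (sub_mem_vectorSpan (mem_coe.2 hx) (mem_coe.2 hy))

variable [DecidableEq V]

lemma dir_insert_left (a : V) {A B : Finset V} {p : V} (hp : p ∈ A) :
    dir (insert a A) B = dir A B ⊔ Submodule.span ℝ {a - p} := by
  rw [dir, coe_insert, vectorSpan_insert_eq_sup a (mem_coe.2 hp), sup_right_comm, dir]

lemma dir_insert_right (b : V) {A B : Finset V} {p : V} (hp : p ∈ B) :
    dir A (insert b B) = dir A B ⊔ Submodule.span ℝ {b - p} := by
  rw [dir_comm, dir_insert_left b hp, dir_comm]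

lemma sub_notMem_dir_of_ne {b : V} {A B : Finset V} {p : V} (hp : p ∈ B)
    (h : dir A (insert b B) ≠ dir A B) : b - p ∉ dir A B := fun hmem => h <| by
  rw [dir_insert_right b hp, sup_eq_left, Submodule.span_singleton_le_iff_mem]
  exact hmem

lemma finrank_dir_insert_right_le [FiniteDimensional ℝ V] (b : V) (A : Finset V) {B : Finset V}
    (hB : B.Nonempty) :
    Module.finrank ℝ (dir A (insert b B)) ≤ Module.finrank ℝ (dir A B) + 1 := by
  obtain ⟨p, hp⟩ := hB
  rw [dir_insert_right b hp]
  refine (Submodule.finrank_add_le_finrank_add_finrank _ _).trans ?_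
  gcongr
  simpa using finrank_span_le_card (R := ℝ) ({b - p} : Set V)

lemma finrank_dir_insert_left_le [FiniteDimensional ℝ V] (a : V) {A : Finset V} (B : Finset V)
    (hA : A.Nonempty) :
    Module.finrank ℝ (dir (insert a A) B) ≤ Module.finrank ℝ (dir A B) + 1 := by
  rw [dir_comm, dir_comm A]
  exact finrank_dir_insert_right_le a B hA

lemma card_add_insert_of_dir_ne {b : V} {A B : Finset V} (hB : B.Nonempty)
    (h : dir A (insert b B) ≠ dir A B) : #(A + B) + #A ≤ #(A + insert b B) := by
  obtain ⟨p, hp⟩ := hB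
  have hb := sub_notMem_dir_of_ne hp h
  rw [← card_image_of_injective A (add_left_injective b)]
  refine card_add_card_le_of_disjoint (add_subset_add_left (subset_insert _ _)) ?_ ?_
  · exact image_subset_iff.2 fun x hx => add_mem_add hx (mem_insert_self _ _)
  · intro _ himage hxAB
    obtain ⟨x, hx, rfl⟩ := mem_image.1 himage
    obtain ⟨y, hy, z, hz, he⟩ := mem_add.1 hxAB
    have : b - p = (y - x) + (z - p) := by
      rw [show b = y + z - x by rw [he]; abel]
      abel
    exact hb (this ▸ add_mem (sub_mem_dir_left B hy hx) (sub_mem_dir_right A hz hp))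

/-- Removing the unique maximisers `a`, `b` of a linear functional from both summands loses more
sums than the dimension. -/
lemma card_add_finrank_add_one_le {φ : V →ₗ[ℝ] ℝ} {a b : V} {A B : Finset V}
    (ha : ∀ x ∈ A, φ x < φ a) (hb : ∀ y ∈ B, φ y < φ b) :
    #(A + B) + (1 + Module.finrank ℝ (dir (insert a A) (insert b B))) ≤
      #(insert a A + insert b B) := by
  set S : Finset V := A.image (a - ·) ∪ B.image (b - ·)
  have hSφ : ∀ s ∈ S, 0 < φ s := by
    intro s hs
    rcases mem_union.1 hs with h | h
    · obtain ⟨x, hx, rfl⟩ := mem_image.1 h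
      simpa using ha x hx
    · obtain ⟨x, hx, rfl⟩ := mem_image.1 h
      simpa using hb x hx
  have hdir : dir (insert a A) (insert b B) ≤ Submodule.span ℝ (S : Set V) := by
    refine sup_le ?_ ?_
    · rw [vectorSpan_eq_span_vsub_set_left ℝ (mem_coe.2 (mem_insert_self a A)), Submodule.span_le]
      rintro _ ⟨x, hx, rfl⟩
      rcases mem_insert.1 (mem_coe.1 hx) with rfl | hx
      · simp
      · exact Submodule.subset_span (mem_coe.2 (mem_union_left _ (mem_image_of_mem _ hx)))
    · rw [vectorSpan_eq_span_vsub_set_left ℝ (mem_coe.2 (mem_insert_self b B)), Submodule.span_le]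
      rintro _ ⟨x, hx, rfl⟩
      rcases mem_insert.1 (mem_coe.1 hx) with rfl | hx
      · simp
      · exact Submodule.subset_span (mem_coe.2 (mem_union_right _ (mem_image_of_mem _ hx)))
  have : FiniteDimensional ℝ (Submodule.span ℝ (S : Set V)) := FiniteDimensional.span_finset ℝ _
  have hrank := (Submodule.finrank_mono hdir).trans (finrank_span_le_card_sdiff_add hSφ)
  have h0 : (0 : V) ∉ S \ (S + S) := fun h => by simpa using hSφ 0 (mem_sdiff.1 h).1
  set T : Finset V := insert 0 (S \ (S + S))
  have hTcard : #T = #(S \ (S + S)) + 1 := card_insert_of_notMem h0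
  have hTS : ∀ t ∈ T, t ∉ S + S := by
    intro t ht
    rcases mem_insert.1 ht with rfl | ht
    · intro h
      obtain ⟨x, hx, y, hy, he⟩ := mem_add.1 h
      have := congrArg φ he
      rw [map_add, map_zero] at this
      linarith [hSφ x hx, hSφ y hy]
    · exact (mem_sdiff.1 ht).2
  have key : #(A + B) + #(T.image (a + b - ·)) ≤ #(insert a A + insert b B) := by
    refine card_add_card_le_of_disjoint
      (add_subset_add (subset_insert _ _) (subset_insert _ _)) ?_ ?_
    · refine image_subset_iff.2 fun t ht => ?_
      rcases mem_insert.1 ht with rfl | ht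
      · rw [sub_zero]
        exact add_mem_add (mem_insert_self _ _) (mem_insert_self _ _)
      · rcases mem_union.1 (mem_sdiff.1 ht).1 with h | h
        · obtain ⟨x, hx, rfl⟩ := mem_image.1 h
          exact mem_add.2 ⟨x, mem_insert_of_mem hx, b, mem_insert_self _ _, by abel⟩
        · obtain ⟨x, hx, rfl⟩ := mem_image.1 h
          exact mem_add.2 ⟨a, mem_insert_self _ _, x, mem_insert_of_mem hx, by abel⟩
    · intro _ himage hAB
      obtain ⟨t, ht, rfl⟩ := mem_image.1 himage
      obtain ⟨x, hx, y, hy, he⟩ := mem_add.1 hAB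
      refine hTS t ht (mem_add.2 ⟨a - x, mem_union_left _ (mem_image_of_mem _ hx), b - y,
        mem_union_right _ (mem_image_of_mem _ hy), ?_⟩)
      rw [show a - x + (b - y) = a + b - (x + y) by abel, he]
      abel
  rw [card_image_of_injective _ sub_right_injective] at key
  lia

/-- If adding `a` to `A` enlarges the space of directions, then adding the unique maximisers `a`,
`b` of a linear functional gains at least `|B| + 1` sums. -/
lemma card_add_card_add_one_le {φ : V →ₗ[ℝ] ℝ} {a b : V} {A B : Finset V} (hA : A.Nonempty)
    (hne : dir (insert a A) B ≠ dir A B)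
    (ha : ∀ x ∈ A, φ x < φ a) (hb : ∀ y ∈ B, φ y < φ b) :
    #(A + B) + (#B + 1) ≤ #(insert a A + insert b B) := by
  obtain ⟨p, hp⟩ := hA
  have hap : a - p ∉ dir B A := sub_notMem_dir_of_ne hp (by rwa [dir_comm, dir_comm B])
  have hbB : b ∉ B := fun h => (hb b h).false
  rw [← card_insert_of_notMem hbB,
    ← card_image_of_injective (insert b B) (add_right_injective a)]
  refine card_add_card_le_of_disjoint
    (add_subset_add (subset_insert _ _) (subset_insert _ _)) ?_ ?_
  · exact image_subset_iff.2 fun x hx => add_mem_add (mem_insert_self _ _) hx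
  · intro _ himage hxAB
    obtain ⟨x, hx, rfl⟩ := mem_image.1 himage
    obtain ⟨y, hy, z, hz, he⟩ := mem_add.1 hxAB
    rcases mem_insert.1 hx with rfl | hx
    · have := congrArg φ he
      simp only [map_add] at this
      linarith [ha y hy, hb z hz]
    · have : a - p = (z - x) + (y - p) := by
        rw [show a = y + z - x by rw [he]; abel]
        abel
      exact hap (this ▸ add_mem (sub_mem_dir_left A hz hx) (sub_mem_dir_right B hy hp))

lemma exists_linear_injOn [FiniteDimensional ℝ V] (S : Finset V) :
    ∃ φ : V →ₗ[ℝ] ℝ, Set.InjOn φ (S : Set V) := by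
  obtain ⟨φ, hφ⟩ := Module.exists_dual_forall_apply_ne_zero (K := ℝ)
    (fun s : {x // x ∈ (S - S).erase 0} => (s : V)) fun s => (mem_erase.1 s.2).1
  refine ⟨φ, fun x hx y hy hxy => ?_⟩
  by_contra hne
  refine hφ ⟨x - y, mem_erase.2 ⟨sub_ne_zero.2 hne, sub_mem_sub hx hy⟩⟩ ?_
  rw [map_sub, hxy, sub_self]

lemma exists_insert_eq_of_injOn {A : Finset V} (hA : A.Nonempty) {φ : V →ₗ[ℝ] ℝ}
    (hφ : Set.InjOn φ (A : Set V)) :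
    ∃ a A', insert a A' = A ∧ #A = #A' + 1 ∧ ∀ x ∈ A', φ x < φ a := by
  obtain ⟨a, ha, hmax⟩ := A.exists_max_image φ hA
  refine ⟨a, A.erase a, insert_erase ha, (card_erase_add_one ha).symm, fun x hx => ?_⟩
  obtain ⟨hxa, hx⟩ := mem_erase.1 hx
  exact (hmax x hx).lt_of_ne fun h => hxa (hφ hx ha h)

theorem bound_finrank_dir_le_card_add [FiniteDimensional ℝ V] (A B : Finset V)
    (hA : A.Nonempty) (hAB : #A ≤ #B) :
    bound (Module.finrank ℝ (dir A B)) #A #B ≤ #(A + B) := by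
  induction hN : #A + #B using Nat.strong_induction_on generalizing A B with
  | _ N ih =>
  have hB : B.Nonempty := card_pos.1 (hA.card_pos.trans_le hAB)
  obtain ⟨φ, hφ⟩ := exists_linear_injOn (A ∪ B)
  obtain ⟨a, A', rfl, hAc, ha⟩ := exists_insert_eq_of_injOn hA
    (hφ.mono (coe_subset.2 subset_union_left))
  obtain ⟨b, B', rfl, hBc, hb⟩ := exists_insert_eq_of_injOn hB
    (hφ.mono (coe_subset.2 subset_union_right))
  rcases A'.eq_empty_or_nonempty with rfl | hA'
  · simp [bound]
  have hB' : B'.Nonempty := card_pos.1 (by have := hA'.card_pos; lia)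
  obtain ⟨k, hk⟩ : ∃ k, #A' = k + 1 := ⟨#A' - 1, by have := hA'.card_pos; lia⟩
  obtain ⟨l, hl⟩ : ∃ l, #B' = l + 1 := ⟨#B' - 1, by have := hB'.card_pos; lia⟩
  have hkl : k ≤ l := by lia
  rw [hk] at hAc
  rw [hl] at hBc
  by_cases h₂ : dir (insert a A') (insert b B') = dir (insert a A') B'
  swap
  · have hcard := card_add_insert_of_dir_ne hB' h₂
    have hrank := finrank_dir_insert_right_le b (insert a A') hB'
    rcases hkl.lt_or_eq with hlt | rfl
    · have hrec := ih _ (by lia) (insert a A') B' hA (by lia) rfl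
      have := bound_le_remove_right hrank k l
      rw [hAc, hl] at hrec
      rw [hAc] at hcard
      rw [hAc, hBc]
      lia
    · have hrec := ih _ (by lia) B' (insert a A') hB' (by lia) rfl
      have := bound_le_remove_left hrank (le_refl k)
      rw [hAc, hl, dir_comm, add_comm B'] at hrec
      rw [hAc] at hcard
      rw [hAc, hBc]
      lia
  by_cases h₃ : dir (insert a A') (insert b B') = dir A' (insert b B')
  swap
  · have hcard := card_add_insert_of_dir_ne (A := insert b B') hA'
      (by rwa [dir_comm, dir_comm _ A'])
    have hrank := finrank_dir_insert_left_le a (insert b B') hA'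
    have hrec := ih _ (by lia) A' (insert b B') hA' (by lia) rfl
    have := bound_le_remove_left hrank hkl
    rw [hBc, hk] at hrec
    rw [hBc, add_comm, add_comm (insert b B') (insert a A'), add_comm (insert b B') A'] at hcard
    rw [hAc, hBc]
    lia
  have hrec := ih _ (by lia) A' B' hA' (by lia) rfl
  rw [hk, hl] at hrec
  rw [hAc, hBc]
  by_cases h₁ : dir (insert a A') (insert b B') = dir A' B'
  · have hcard := card_add_finrank_add_one_le ha hb
    rw [bound_succ_succ, h₁]
    rw [h₁] at hcard
    lia
  · have hrank := finrank_dir_insert_left_le a B' hA'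
    rw [← h₂] at hrank
    have hcard := card_add_card_add_one_le (b := b) hA' (h₂ ▸ h₁) ha hb
    have := bound_le_remove_both hrank hkl
    rw [hl] at hcard
    lia

end Ruzsa

/-- Ruzsa's refined bound: for finite sets `A, B ⊆ ℝⁿ` with `|A| ≤ |B|` whose Minkowski sum
affinely spans `ℝⁿ`, one has `|A+B| ≥ |B| + ∑_{i=1}^{|A|-1} min {n, |B|-i}`. -/
theorem ruzsa_sumset_lower_bound_refined (n : ℕ) (hn : 1 ≤ n)
    (A B : Finset (Fin n → ℝ)) (hA : A.Nonempty) (hB : B.Nonempty)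
    (hAB : A.card ≤ B.card)
    (hspan : affineSpan ℝ ((A + B : Finset (Fin n → ℝ)) : Set (Fin n → ℝ)) = ⊤) :
    B.card + ∑ i ∈ Finset.Icc 1 (A.card - 1), min n (B.card - i) ≤ (A + B).card := by
  have hdir : Ruzsa.dir A B = ⊤ := by
    rw [eq_top_iff, ← AffineSubspace.direction_top ℝ (Fin n → ℝ) (Fin n → ℝ), ← hspan,
      direction_affineSpan, Finset.coe_add]
    exact Ruzsa.vectorSpan_add_le _ _
  have h := Ruzsa.bound_finrank_dir_le_card_add A B hA hAB
  rwa [hdir, finrank_top, Module.finrank_fin_fun, Ruzsa.bound_eq_sum_Icc] at h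
end

section
/- Let $A$ and $B$ be nonempty finite subsets of $\mathbb{R}^n$ with $K = |A| \leq |B| = L$, and suppose the affine span of the Minkowski sum $A+B$ is all of $\mathbb{R}^n$. If $n = K + L - 2$, then $|A+B| = K \cdot L$. -/
open scoped Pointwise

/-- If `A, B ⊆ ℝⁿ` are finite, `K = |A| ≤ |B| = L`, the Minkowski sum `A + B` affinely
spans `ℝⁿ`, and `n = K + L - 2`, then `|A+B| = K·L`. -/
theorem sumset_card_eq_of_dim_eq (n : ℕ)
    (A B : Finset (Fin n → ℝ)) (hA : A.Nonempty) (hB : B.Nonempty)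
    (hAB : A.card ≤ B.card)
    (hspan : affineSpan ℝ ((A + B : Finset (Fin n → ℝ)) : Set (Fin n → ℝ)) = ⊤)
    (hn : (n : ℤ) = A.card + B.card - 2) :
    (A + B).card = A.card * B.card := by
  classical
  rw [Finset.card_add_iff]
  rintro ⟨a, b⟩ hab ⟨a', b'⟩ hab' heq
  simp only [Set.mem_prod, Finset.mem_coe] at hab hab' heq
  obtain ⟨ha, hb⟩ := hab
  obtain ⟨ha', hb'⟩ := hab'
  by_contra hne
  have haa : a ≠ a' := by
    rintro rfl
    exact hne (by rw [add_left_cancel heq])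
  have hdiff : a - a' = -(b - b') := by
    rw [neg_sub, sub_eq_sub_iff_add_eq_add, heq, add_comm]
  -- The relation makes the vector `a - a'` redundant among the `n` spanning differences.
  let S : Finset (Fin n → ℝ) :=
    ((A.erase a').erase a).image (· - a') ∪ (B.erase b').image (· - b')
  have hBS : ∀ y ∈ B, y - b' ∈ Submodule.span ℝ (S : Set (Fin n → ℝ)) := by
    intro y hy
    by_cases h : y = b'
    · simp [h]
    · exact Submodule.subset_span (Finset.mem_union_right _
        (Finset.mem_image_of_mem _ (Finset.mem_erase.2 ⟨h, hy⟩)))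
  have hAS : ∀ x ∈ A, x - a' ∈ Submodule.span ℝ (S : Set (Fin n → ℝ)) := by
    intro x hx
    by_cases h : x = a'
    · simp [h]
    by_cases h' : x = a
    · rw [h', hdiff]
      exact Submodule.neg_mem _ (hBS b hb)
    · exact Submodule.subset_span (Finset.mem_union_left _
        (Finset.mem_image_of_mem _ (Finset.mem_erase.2 ⟨h', Finset.mem_erase.2 ⟨h, hx⟩⟩)))
  have htop : Submodule.span ℝ (S : Set (Fin n → ℝ)) = ⊤ := by
    rw [eq_top_iff, ← AffineSubspace.direction_top ℝ (Fin n → ℝ) (Fin n → ℝ), ← hspan,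
      direction_affineSpan,
      vectorSpan_eq_span_vsub_set_right ℝ (Finset.mem_coe.2 (Finset.add_mem_add ha' hb')),
      Submodule.span_le]
    rintro _ ⟨z, hz, rfl⟩
    obtain ⟨x, hx, y, hy, rfl⟩ := Finset.mem_add.1 (Finset.mem_coe.1 hz)
    have h := Submodule.add_mem _ (hAS x hx) (hBS y hy)
    rwa [← add_sub_add_comm] at h
  have hcard : n ≤ S.card := by
    have h := finrank_span_finset_le_card (R := ℝ) S
    rwa [Set.finrank, htop, finrank_top, Module.finrank_fin_fun] at h
  have hS : S.card ≤ ((A.erase a').erase a).card + (B.erase b').card :=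
    (Finset.card_union_le _ _).trans (add_le_add Finset.card_image_le Finset.card_image_le)
  have h₁ := Finset.card_erase_add_one (Finset.mem_erase.2 ⟨haa, ha⟩)
  have h₂ := Finset.card_erase_add_one ha'
  have h₃ := Finset.card_erase_add_one hb'
  omega
end

section
/- Let $A$ and $B$ be nonempty finite subsets of $\mathbb{R}^n$ with $K = |A| \leq |B| = L$, and suppose the affine span of the Minkowski sum $A+B$ is all of $\mathbb{R}^n$. If $1 \leq n \leq L - K$, then $|A+B| \geq L + n(K-1)$. -/
open scoped Pointwise

section SumsetDimension

variable {k E : Type*} [Field k] [AddCommGroup E] [Module k E]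

/-- The direction of `A + B` is contained in the sum of the directions of `A` and `B`. -/
theorem vectorSpan_add_le_sup (s t : Set E) :
    vectorSpan k (s + t) ≤ vectorSpan k s ⊔ vectorSpan k t := by
  rw [vectorSpan_def, Submodule.span_le]
  rintro _ ⟨_, ⟨x, hx, y, hy, rfl⟩, _, ⟨x', hx', y', hy', rfl⟩, rfl⟩
  have h : (x + y) -ᵥ (x' + y') = (x -ᵥ x') + (y -ᵥ y') := by
    simp only [vsub_eq_sub]; abel
  simp only [h]
  exact Submodule.add_mem_sup (vsub_mem_vectorSpan k hx hx') (vsub_mem_vectorSpan k hy hy')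

theorem vectorSpan_insert_eq_sup_span (s : Set E) {a p : E} (hp : p ∈ s) :
    vectorSpan k (insert a s) = vectorSpan k s ⊔ Submodule.span k {a - p} := by
  rw [vectorSpan_eq_span_vsub_set_right k (Set.mem_insert_of_mem a hp),
    vectorSpan_eq_span_vsub_set_right k hp, Set.image_insert_eq, Submodule.span_insert, sup_comm,
    vsub_eq_sub]

theorem finrank_vectorSpan_insert_sup_le [FiniteDimensional k E] {s t : Set E} (a : E)
    (hs : s.Nonempty) :
    Module.finrank k ↥(vectorSpan k (insert a s) ⊔ vectorSpan k t) ≤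
      Module.finrank k ↥(vectorSpan k s ⊔ vectorSpan k t) + 1 := by
  obtain ⟨p, hp⟩ := hs
  rw [vectorSpan_insert_eq_sup_span s hp, sup_right_comm]
  refine (Submodule.finrank_add_le_finrank_add_finrank _ _).trans ?_
  gcongr
  simpa using finrank_span_le_card (R := k) ({a - p} : Set E)

variable [DecidableEq E]

/-- If removing `a` from `A` decreases the joint direction of `A` and `B`, then the translate
`a + B` is disjoint from `A.erase a + B`. -/
theorem card_erase_add_add_card_le {A B : Finset E} {a : E} (ha : a ∈ A)
    (h : vectorSpan k (A.erase a : Set E) ⊔ vectorSpan k (B : Set E) ≠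
      vectorSpan k (A : Set E) ⊔ vectorSpan k (B : Set E)) :
    (A.erase a + B).card + B.card ≤ (A + B).card := by
  have hdisj : Disjoint (A.erase a + B) ({a} + B) := by
    rw [Finset.disjoint_left]
    intro x hx hx'
    obtain ⟨p, hp, q, hq, rfl⟩ := Finset.mem_add.1 hx
    obtain ⟨c, hc, r, hr, hcr⟩ := Finset.mem_add.1 hx'
    rw [Finset.mem_singleton] at hc
    subst hc
    apply h
    have hins : (A : Set E) = insert c (A.erase c : Set E) := by
      rw [← Finset.coe_insert, Finset.insert_erase ha]
    rw [hins, vectorSpan_insert_eq_sup_span _ (Finset.mem_coe.2 hp), sup_right_comm, eq_comm,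
      sup_eq_left, Submodule.span_singleton_le_iff_mem]
    have hcp : c - p = q -ᵥ r := by
      rw [vsub_eq_sub, sub_eq_sub_iff_add_eq_add, hcr, add_comm]
    rw [hcp]
    exact Submodule.mem_sup_right (vsub_mem_vectorSpan k hq hr)
  rw [← Finset.card_singleton_add a B, ← Finset.card_union_of_disjoint hdisj]
  exact Finset.card_le_card (Finset.union_subset
    (Finset.add_subset_add_right (Finset.erase_subset _ _))
    (Finset.add_subset_add_right (Finset.singleton_subset_iff.2 ha)))

variable {Γ : Type*} [AddCommGroup Γ] [LinearOrder Γ] [IsOrderedAddMonoid Γ]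

/-- Removing from `A` and `B` their least elements with respect to a translation-invariant linear
order removes at least `dim (A + B) + 1` elements from `A + B`. -/
theorem card_erase_add_erase_add_finrank_lt {A B : Finset E} {a b : E} (g : E →+ Γ)
    (hg : Function.Injective g) (ha : a ∈ A) (hb : b ∈ B)
    (hamin : ∀ x ∈ A, g a ≤ g x) (hbmin : ∀ x ∈ B, g b ≤ g x) :
    (A.erase a + B.erase b).card +
      Module.finrank k ↥(vectorSpan k (A : Set E) ⊔ vectorSpan k (B : Set E)) <
        (A + B).card := by
  have hapos : ∀ x ∈ A.erase a, 0 < g (x - a) := fun x hx ↦ by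
    rw [map_sub, sub_pos]
    exact (hamin x (Finset.mem_of_mem_erase hx)).lt_of_ne
      fun h ↦ Finset.ne_of_mem_erase hx (hg h.symm)
  have hbpos : ∀ x ∈ B.erase b, 0 < g (x - b) := fun x hx ↦ by
    rw [map_sub, sub_pos]
    exact (hbmin x (Finset.mem_of_mem_erase hx)).lt_of_ne
      fun h ↦ Finset.ne_of_mem_erase hx (hg h.symm)
  set T := (A + B) \ (A.erase a + B.erase b) with hT
  have habT : a + b ∈ T := by
    rw [hT, Finset.mem_sdiff]
    refine ⟨Finset.add_mem_add ha hb, fun h ↦ ?_⟩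
    obtain ⟨x, hx, y, hy, hxy⟩ := Finset.mem_add.1 h
    have h0 : g (x - a) + g (y - b) = 0 := by
      rw [← map_add, sub_add_sub_comm, hxy, sub_self, map_zero]
    exact (add_pos (hapos x hx) (hbpos y hy)).ne' h0
  set U := (T.erase (a + b)).image (· - (a + b)) with hU
  set S := A.image (· - a) ∪ B.image (· - b) with hS
  have hSAB : ∀ s ∈ S, a + b + s ∈ A + B := by
    intro s hs
    rcases Finset.mem_union.1 hs with h | h <;> obtain ⟨x, hx, rfl⟩ := Finset.mem_image.1 h
    · exact Finset.mem_add.2 ⟨x, hx, b, hb, by abel⟩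
    · exact Finset.mem_add.2 ⟨a, ha, x, hx, by abel⟩
  have hspan : ∀ s ∈ S, s ∈ Submodule.span k (U : Set E) := by
    by_contra! hne
    obtain ⟨s₀, hs₀, hs₀'⟩ := hne
    classical
    obtain ⟨s, hs, hmin⟩ := Finset.exists_min_image
      (S.filter (· ∉ Submodule.span k (U : Set E))) g ⟨s₀, Finset.mem_filter.2 ⟨hs₀, hs₀'⟩⟩
    obtain ⟨hsS, hsU⟩ := Finset.mem_filter.1 hs
    have hlt : ∀ t ∈ S, g t < g s → t ∈ Submodule.span k (U : Set E) := by
      intro t ht hts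
      by_contra h
      exact (hmin t (Finset.mem_filter.2 ⟨ht, h⟩)).not_gt hts
    by_cases hmem : a + b + s ∈ A.erase a + B.erase b
    · obtain ⟨x, hx, y, hy, hxy⟩ := Finset.mem_add.1 hmem
      have hsxy : s = (x - a) + (y - b) := by
        rw [sub_add_sub_comm, hxy, add_sub_cancel_left]
      have hgs : g s = g (x - a) + g (y - b) := by rw [hsxy, map_add]
      apply hsU
      rw [hsxy]
      refine add_mem (hlt _ ?_ ?_) (hlt _ ?_ ?_)
      · exact Finset.mem_union_left _
          (Finset.mem_image_of_mem _ (Finset.mem_of_mem_erase hx))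
      · rw [hgs]; exact lt_add_of_pos_right _ (hbpos y hy)
      · exact Finset.mem_union_right _
          (Finset.mem_image_of_mem _ (Finset.mem_of_mem_erase hy))
      · rw [hgs]; exact lt_add_of_pos_left _ (hapos x hx)
    · apply hsU
      have hs0 : s ≠ 0 := by
        rintro rfl
        exact hsU (zero_mem _)
      refine Submodule.subset_span (Finset.mem_coe.2 (Finset.mem_image.2 ⟨a + b + s, ?_, ?_⟩))
      · exact Finset.mem_erase.2
          ⟨by simpa using hs0, Finset.mem_sdiff.2 ⟨hSAB s hsS, hmem⟩⟩
      · exact add_sub_cancel_left _ _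
  have hle : vectorSpan k (A : Set E) ⊔ vectorSpan k (B : Set E) ≤
      Submodule.span k (U : Set E) := by
    rw [vectorSpan_eq_span_vsub_set_right k (Finset.mem_coe.2 ha),
      vectorSpan_eq_span_vsub_set_right k (Finset.mem_coe.2 hb)]
    refine sup_le (Submodule.span_le.2 ?_) (Submodule.span_le.2 ?_)
    · rintro _ ⟨x, hx, rfl⟩
      exact hspan _ (Finset.mem_union_left _ (Finset.mem_image_of_mem _ hx))
    · rintro _ ⟨x, hx, rfl⟩
      exact hspan _ (Finset.mem_union_right _ (Finset.mem_image_of_mem _ hx))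
  have hfin : Module.finrank k ↥(vectorSpan k (A : Set E) ⊔ vectorSpan k (B : Set E)) ≤
      (T.erase (a + b)).card :=
    (Submodule.finrank_mono hle).trans
      ((finrank_span_finset_le_card U).trans Finset.card_image_le)
  have hTcard : (T.erase (a + b)).card + 1 = T.card := Finset.card_erase_add_one habT
  have hsub : A.erase a + B.erase b ⊆ A + B :=
    Finset.add_subset_add (Finset.erase_subset _ _) (Finset.erase_subset _ _)
  have hcard : T.card + (A.erase a + B.erase b).card = (A + B).card :=
    Finset.card_sdiff_add_card_eq_card hsub
  omega

/-- If `A + B` has dimension at least `d` and `d ≤ |B| - |A|`, then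
`|A + B| ≥ |B| + d (|A| - 1)`. -/
theorem card_add_mul_le_card_add [FiniteDimensional k E] (g : E →+ Γ)
    (hg : Function.Injective g) {A B : Finset E} {d r : ℕ} (hA : A.card = r + 1)
    (hAB : A.card + d ≤ B.card)
    (hd : d ≤ Module.finrank k ↥(vectorSpan k (A : Set E) ⊔ vectorSpan k (B : Set E))) :
    B.card + d * r ≤ (A + B).card := by
  induction hN : A.card + B.card using Nat.strong_induction_on generalizing A B d r with
  | _ N ih =>
  have hAne : A.Nonempty := Finset.card_pos.1 (by omega)
  have hBne : B.Nonempty := Finset.card_pos.1 (by omega)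
  have htriv : B.card ≤ (A + B).card := Finset.card_le_card_add_left hAne
  obtain _ | e := d
  · simpa using htriv
  obtain _ | j := r
  · simpa using htriv
  obtain ⟨a, ha, hamin⟩ := Finset.exists_min_image A g hAne
  obtain ⟨b, hb, hbmin⟩ := Finset.exists_min_image B g hBne
  have hA' : (A.erase a).card + 1 = A.card := Finset.card_erase_add_one ha
  have hB' : (B.erase b).card + 1 = B.card := Finset.card_erase_add_one hb
  have hA'ne : (A.erase a).Nonempty := Finset.card_pos.1 (by omega)
  have hB'ne : (B.erase b).Nonempty := Finset.card_pos.1 (by omega)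
  have hAins : (A : Set E) = insert a (A.erase a : Set E) := by
    rw [← Finset.coe_insert, Finset.insert_erase ha]
  have hBins : (B : Set E) = insert b (B.erase b : Set E) := by
    rw [← Finset.coe_insert, Finset.insert_erase hb]
  by_cases h₁ : vectorSpan k (B.erase b : Set E) ⊔ vectorSpan k (A : Set E) =
      vectorSpan k (B : Set E) ⊔ vectorSpan k (A : Set E)
  · by_cases h₂ : vectorSpan k (A.erase a : Set E) ⊔ vectorSpan k (B.erase b : Set E) =
        vectorSpan k (A : Set E) ⊔ vectorSpan k (B.erase b : Set E)
    · have hgain := card_erase_add_erase_add_finrank_lt (k := k) g hg ha hb hamin hbmin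
      have := ih _ (by omega) (A := A.erase a) (B := B.erase b) (d := e + 1) (r := j)
        (by omega) (by omega) (by rwa [h₂, sup_comm, h₁, sup_comm]) rfl
      have hmul : (e + 1) * (j + 1) = (e + 1) * j + (e + 1) := by ring
      omega
    · have hdisj := card_erase_add_add_card_le ha h₂
      have hrank := finrank_vectorSpan_insert_sup_le (k := k) (t := (B.erase b : Set E)) a
        (Finset.coe_nonempty.2 hA'ne)
      rw [← hAins, sup_comm, h₁, sup_comm] at hrank
      have := ih _ (by omega) (A := A.erase a) (B := B.erase b) (d := e) (r := j)
        (by omega) (by omega) (by omega) rfl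
      have hmono : (A + B.erase b).card ≤ (A + B).card :=
        Finset.card_le_card (Finset.add_subset_add_left (Finset.erase_subset _ _))
      have hmul : (e + 1) * (j + 1) = e * j + e + j + 1 := by ring
      omega
  · have hdisj := card_erase_add_add_card_le hb h₁
    rw [add_comm _ A, add_comm _ A] at hdisj
    have hrank := finrank_vectorSpan_insert_sup_le (k := k) (t := (A : Set E)) b
      (Finset.coe_nonempty.2 hB'ne)
    rw [← hBins, sup_comm, sup_comm _ (vectorSpan k (A : Set E))] at hrank
    have := ih _ (by omega) (A := A) (B := B.erase b) (d := e) (r := j + 1)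
      (by omega) (by omega) (by omega) rfl
    have hmul : (e + 1) * (j + 1) = e * (j + 1) + j + 1 := by ring
    omega

end SumsetDimension

/-- If `A, B ⊆ ℝⁿ` are finite, `K = |A| ≤ |B| = L`, the Minkowski sum `A + B` affinely
spans `ℝⁿ`, and `1 ≤ n ≤ L - K`, then `|A+B| ≥ L + n(K-1)`. -/
theorem sumset_card_lower_bound_small_dim (n : ℕ)
    (A B : Finset (Fin n → ℝ)) (hA : A.Nonempty) (hB : B.Nonempty)
    (hAB : A.card ≤ B.card)
    (hspan : affineSpan ℝ ((A + B : Finset (Fin n → ℝ)) : Set (Fin n → ℝ)) = ⊤)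
    (hn1 : 1 ≤ n) (hn2 : (n : ℤ) ≤ B.card - A.card) :
    (B.card : ℤ) + n * (A.card - 1) ≤ ((A + B).card : ℤ) := by
  have htop : vectorSpan ℝ (A : Set (Fin n → ℝ)) ⊔ vectorSpan ℝ (B : Set (Fin n → ℝ)) = ⊤ := by
    rw [eq_top_iff, ← AffineSubspace.direction_top ℝ (Fin n → ℝ) (Fin n → ℝ), ← hspan,
      direction_affineSpan, Finset.coe_add]
    exact vectorSpan_add_le_sup _ _
  obtain ⟨m, hm⟩ := Nat.exists_eq_succ_of_ne_zero hA.card_pos.ne'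
  have h := card_add_mul_le_card_add (k := ℝ) (B := B) (d := n)
    (toLexAddEquiv (Fin n → ℝ)).toAddMonoidHom (toLexAddEquiv (Fin n → ℝ)).injective hm
    (by omega) (by rw [htop, finrank_top, Module.finrank_fin_fun])
  rw [hm]
  push_cast
  rw [add_sub_cancel_right]
  exact_mod_cast h
end

section
/- Let $A$ and $B$ be nonempty finite subsets of $\mathbb{R}^n$ with $K = |A| \leq |B| = L$, and suppose the affine span of the Minkowski sum $A+B$ is all of $\mathbb{R}^n$. If $\max\{1, L-K\} \leq n \leq L$, then $|A+B| \geq (n+1)K - \frac{(n-L+K)(n-L+K+1)}{2}$. -/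
open scoped Pointwise

open Finset

/-- A lower bound for the size of a `d`-dimensional sumset of sets of sizes `K, L ≥ 1`. -/
def sumsetBound (d K L : ℕ) : ℕ :=
  max K L + ∑ i ∈ range (min K L - 1), min d (max K L - min K L + 1 + i)

theorem sumsetBound_comm (d K L : ℕ) : sumsetBound d K L = sumsetBound d L K := by
  simp only [sumsetBound, max_comm, min_comm K L]

theorem sumsetBound_mono {d d' : ℕ} (h : d ≤ d') (K L : ℕ) :
    sumsetBound d K L ≤ sumsetBound d' K L := by
  unfold sumsetBound
  gcongr

theorem sumsetBound_eq (d k e : ℕ) :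
    sumsetBound d (k + 1) (k + 1 + e) = k + 1 + e + ∑ i ∈ range k, min d (e + 1 + i) := by
  simp [sumsetBound]

theorem exists_add_eq_or {K L : ℕ} (hK : 1 ≤ K) (hL : 1 ≤ L) :
    ∃ k e, K = k + 1 ∧ L = k + 1 + e ∨ L = k + 1 ∧ K = k + 1 + e := by
  rcases le_total K L with h | h
  · exact ⟨K - 1, L - K, by omega⟩
  · exact ⟨L - 1, K - L, by omega⟩

theorem sumsetBound_succ_succ_le {d K L : ℕ} (hK : 1 ≤ K) (hL : 1 ≤ L) :
    sumsetBound d (K + 1) (L + 1) ≤ sumsetBound d K L + (d + 1) := by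
  obtain ⟨k, e, ⟨rfl, rfl⟩ | ⟨rfl, rfl⟩⟩ := exists_add_eq_or hK hL
  on_goal 2 => rw [sumsetBound_comm, sumsetBound_comm d (k + 1 + e)]
  all_goals
    rw [sumsetBound_eq, add_right_comm _ e 1, sumsetBound_eq, sum_range_succ]
    omega

theorem sumsetBound_succ_right_le {d K L : ℕ} (hK : 1 ≤ K) (hL : 1 ≤ L) :
    sumsetBound (d + 1) K (L + 1) ≤ sumsetBound d K L + K := by
  rcases le_or_gt K L with h | h
  · obtain ⟨k, rfl⟩ := Nat.exists_eq_add_of_le' hK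
    obtain ⟨e, rfl⟩ := Nat.exists_eq_add_of_le h
    rw [sumsetBound_eq, add_assoc _ e 1, sumsetBound_eq]
    have : ∑ i ∈ range k, min (d + 1) (e + 1 + 1 + i)
        = ∑ i ∈ range k, (min d (e + 1 + i) + 1) := sum_congr rfl fun i _ => by omega
    rw [this, sum_add_distrib]
    simp
    omega
  · obtain ⟨k, rfl⟩ := Nat.exists_eq_add_of_le' hL
    obtain ⟨e, rfl⟩ := Nat.exists_eq_add_of_le (show k + 1 + 1 ≤ K from h)
    have heq := sumsetBound_eq d k (e + 1)
    rw [add_comm e 1, ← add_assoc (k + 1), add_comm 1 e] at heq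
    rw [sumsetBound_comm, sumsetBound_eq, sumsetBound_comm, heq, sum_range_succ']
    have : ∑ i ∈ range k, min (d + 1) (e + 1 + (i + 1))
        ≤ ∑ i ∈ range k, (min d (e + 1 + 1 + i) + 1) := sum_le_sum fun i _ => by omega
    rw [sum_add_distrib] at this
    simp at this
    omega

theorem sumsetBound_add_one_succ_succ_le {d K L : ℕ} (hK : 1 ≤ K) (hL : 1 ≤ L) :
    sumsetBound (d + 1) (K + 1) (L + 1) ≤ sumsetBound d K L + (max K L + 1) := by
  have key (e k : ℕ) : ∑ i ∈ range (k + 1), min (d + 1) (e + 1 + i)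
      ≤ ∑ i ∈ range k, min d (e + 1 + i) + (e + 1 + k) := by
    induction k with
    | zero => simp
    | succ k ih =>
      rw [sum_range_succ _ (k + 1), sum_range_succ (fun i => min d (e + 1 + i)) k]
      omega
  obtain ⟨k, e, ⟨rfl, rfl⟩ | ⟨rfl, rfl⟩⟩ := exists_add_eq_or hK hL
  on_goal 2 => rw [sumsetBound_comm, sumsetBound_comm d (k + 1 + e)]
  all_goals
    rw [sumsetBound_eq, add_right_comm _ e 1, sumsetBound_eq]
    have := key e k
    omega

theorem sumsetBound_add_two_succ_succ_le {d K L : ℕ} (hK : 1 ≤ K) (hL : 1 ≤ L) :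
    sumsetBound (d + 2) (K + 1) (L + 1) ≤ sumsetBound d K L + (K + L + 1) := by
  have key (e k : ℕ) : ∑ i ∈ range (k + 1), min (d + 2) (e + 1 + i)
      ≤ ∑ i ∈ range k, min d (e + 1 + i) + (2 * k + 2 + e) := by
    induction k with
    | zero => simp
    | succ k ih =>
      rw [sum_range_succ _ (k + 1), sum_range_succ (fun i => min d (e + 1 + i)) k]
      omega
  obtain ⟨k, e, ⟨rfl, rfl⟩ | ⟨rfl, rfl⟩⟩ := exists_add_eq_or hK hL
  on_goal 2 => rw [sumsetBound_comm, sumsetBound_comm d (k + 1 + e)]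
  all_goals
    rw [sumsetBound_eq, add_right_comm _ e 1, sumsetBound_eq]
    have := key e k
    omega

theorem le_sumsetBound {n K L : ℕ} (hK : 1 ≤ K) (hKL : K ≤ L) (h₁ : L ≤ n + K) (h₂ : n ≤ L) :
    ((n : ℤ) + 1) * K - ((n : ℤ) - L + K) * ((n : ℤ) - L + K + 1) / 2 ≤ sumsetBound n K L := by
  obtain ⟨k, rfl⟩ := Nat.exists_eq_add_of_le' hK
  obtain ⟨e, rfl⟩ := Nat.exists_eq_add_of_le hKL
  obtain ⟨m, rfl⟩ := Nat.exists_eq_add_of_le (show e ≤ n by omega)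
  have key (k : ℕ) : 2 * ((e : ℤ) + m) * k + max ((m : ℤ) - k) 0 * (max ((m : ℤ) - k) 0 - 1)
      ≤ 2 * ((∑ i ∈ range k, min (e + m) (e + 1 + i) : ℕ) : ℤ) + m * (m - 1) := by
    induction k with
    | zero => simp
    | succ k ih =>
      rw [sum_range_succ]
      rcases lt_or_ge k m with h | h
      · rw [max_eq_left (by omega)] at ih ⊢
        rw [min_eq_right (by omega)]
        push_cast at ih ⊢
        linarith
      · rw [max_eq_right (by omega)] at ih ⊢
        rw [min_eq_left (by omega)]
        push_cast at ih ⊢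
        linarith
  have hk := key k
  have hpos : 0 ≤ max ((m : ℤ) - k) 0 * (max ((m : ℤ) - k) 0 - 1) := by
    rcases lt_or_ge k m with h | h
    · exact mul_nonneg (by omega) (by omega)
    · simp [max_eq_right (show (m : ℤ) - k ≤ 0 by omega)]
  obtain ⟨r, hr⟩ := Int.even_mul_succ_self (m : ℤ)
  rw [sumsetBound_eq]
  push_cast at hk ⊢
  have hm : ((e : ℤ) + m - (k + 1 + e) + (k + 1)) = m := by ring
  rw [hm, hr, ← two_mul, Int.mul_ediv_cancel_left _ two_ne_zero]
  linarith

section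

variable {𝕜 V : Type*} [Field 𝕜] [AddCommGroup V] [Module 𝕜 V]

theorem finrank_sup_span_singleton_le [FiniteDimensional 𝕜 V] (p : Submodule 𝕜 V) (v : V) :
    Module.finrank 𝕜 (p ⊔ Submodule.span 𝕜 {v} : Submodule 𝕜 V) ≤ Module.finrank 𝕜 p + 1 := by
  by_cases hv : v ∈ p
  · rw [sup_eq_left.2 (by simpa using hv)]
    omega
  · exact (Submodule.finrank_sup_span_singleton hv).le

theorem mem_iff_of_vectorSpan_le {W : Submodule 𝕜 V} {S : Set V} (hS : vectorSpan 𝕜 S ≤ W)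
    {x y : V} (hx : x ∈ S) (hy : y ∈ S) : x ∈ W ↔ y ∈ W := by
  have h : x - y ∈ W := hS (vsub_mem_vectorSpan 𝕜 hx hy)
  exact ⟨fun hxW => by simpa using W.sub_mem hxW h, fun hyW => by simpa using W.add_mem h hyW⟩

theorem span_union_le_sup_sup {W : Submodule 𝕜 V} {S T : Set V} (hS : vectorSpan 𝕜 S ≤ W)
    (hT : vectorSpan 𝕜 T ≤ W) {a b : V} (ha : a ∈ S) (hb : b ∈ T) :
    Submodule.span 𝕜 (S ∪ T) ≤ W ⊔ Submodule.span 𝕜 {a} ⊔ Submodule.span 𝕜 {b} := by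
  set U := W ⊔ Submodule.span 𝕜 {a} ⊔ Submodule.span 𝕜 {b}
  have hWU : W ≤ U := le_sup_left.trans le_sup_left
  have haU : a ∈ U :=
    Submodule.mem_sup_left (Submodule.mem_sup_right (Submodule.mem_span_singleton_self a))
  have hbU : b ∈ U := Submodule.mem_sup_right (Submodule.mem_span_singleton_self b)
  rw [Submodule.span_le]
  rintro x (hx | hx)
  · exact (mem_iff_of_vectorSpan_le (hS.trans hWU) hx ha).2 haU
  · exact (mem_iff_of_vectorSpan_le (hT.trans hWU) hx hb).2 hbU

theorem vectorSpan_add_le_s4 (S T : Set V) :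
    vectorSpan 𝕜 (S + T) ≤ vectorSpan 𝕜 S ⊔ vectorSpan 𝕜 T := by
  rw [vectorSpan_def, Submodule.span_le]
  rintro _ ⟨_, ⟨s, hs, t, ht, rfl⟩, _, ⟨s', hs', t', ht', rfl⟩, rfl⟩
  have : (s + t) -ᵥ (s' + t') = (s -ᵥ s') + (t -ᵥ t') := by simp only [vsub_eq_sub]; abel
  change (s + t) -ᵥ (s' + t') ∈ vectorSpan 𝕜 S ⊔ vectorSpan 𝕜 T
  rw [this]
  exact Submodule.add_mem_sup (vsub_mem_vectorSpan 𝕜 hs hs') (vsub_mem_vectorSpan 𝕜 ht ht')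

variable [LinearOrder V]

/-- The lower bound for `|A + B|` in terms of `|A|`, `|B|` and the dimension of `A + B`. -/
def SumsetBoundHolds (𝕜 : Type*) [Field 𝕜] [Module 𝕜 V] (A B : Finset V) : Prop :=
  sumsetBound (Module.finrank 𝕜 ↥(vectorSpan 𝕜 (A : Set V) ⊔ vectorSpan 𝕜 (B : Set V)))
    #A #B ≤ #(A + B)

theorem SumsetBoundHolds.symm {A B : Finset V} (h : SumsetBoundHolds 𝕜 A B) :
    SumsetBoundHolds 𝕜 B A := by
  rwa [SumsetBoundHolds, sumsetBound_comm, sup_comm, add_comm]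

theorem sumsetBound_le_of_mem_of_notMem [FiniteDimensional 𝕜 V] {A B : Finset V}
    (hA : 0 ∉ A) {a b : V} (ha : a ∈ A) (hb : b ∈ B) (ih : SumsetBoundHolds 𝕜 (insert 0 A) B)
    {W : Submodule 𝕜 V} (hW : W = vectorSpan 𝕜 (A : Set V) ⊔ vectorSpan 𝕜 (B : Set V))
    (haW : a ∈ W) (hbW : b ∉ W) :
    sumsetBound (Module.finrank 𝕜 (Submodule.span 𝕜 ((A : Set V) ∪ B))) (#A + 1) (#B + 1)
      ≤ #(insert 0 A + insert 0 B) := by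
  have hAW : vectorSpan 𝕜 (A : Set V) ≤ W := hW ▸ le_sup_left
  have hBW : vectorSpan 𝕜 (B : Set V) ≤ W := hW ▸ le_sup_right
  have hdim : Module.finrank 𝕜 (Submodule.span 𝕜 ((A : Set V) ∪ B)) ≤ Module.finrank 𝕜 W + 1 := by
    refine (Submodule.finrank_mono (span_union_le_sup_sup hAW hBW ha hb)).trans ?_
    rw [sup_eq_left.2 (by simpa using haW : Submodule.span 𝕜 {a} ≤ W)]
    exact finrank_sup_span_singleton_le W b
  have hA0 : #(insert 0 A) = #A + 1 := card_insert_of_notMem hA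
  have hA0W : ∀ x ∈ insert 0 A, x ∈ W := by
    intro x hx
    rcases mem_insert.1 hx with rfl | hx
    · exact W.zero_mem
    · exact (mem_iff_of_vectorSpan_le hAW hx ha).2 haW
  have hdisj : Disjoint (insert 0 A + B) (insert 0 A) := by
    rw [disjoint_left]
    rintro x hx hx'
    obtain ⟨y, hy, z, hz, rfl⟩ := mem_add.1 hx
    exact hbW ((mem_iff_of_vectorSpan_le hBW hb hz).2
      (by simpa using W.sub_mem (hA0W _ hx') (hA0W y hy)))
  have hsub : (insert 0 A + B) ∪ insert 0 A ⊆ insert 0 A + insert 0 B :=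
    union_subset (add_subset_add_left (subset_insert _ _))
      fun x hx => mem_add.2 ⟨x, hx, 0, mem_insert_self _ _, add_zero x⟩
  have hWle : W ≤ vectorSpan 𝕜 ((insert 0 A : Finset V) : Set V) ⊔ vectorSpan 𝕜 (B : Set V) :=
    hW ▸ sup_le_sup_right (vectorSpan_mono 𝕜 (coe_subset.2 (subset_insert _ _))) _
  calc _ ≤ sumsetBound (Module.finrank 𝕜 W + 1) (#A + 1) (#B + 1) := sumsetBound_mono hdim _ _
    _ ≤ sumsetBound (Module.finrank 𝕜 W) (#A + 1) #B + (#A + 1) :=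
      sumsetBound_succ_right_le (by omega) (card_pos.2 ⟨b, hb⟩)
    _ ≤ #(insert 0 A + B) + #(insert 0 A) := by
      rw [SumsetBoundHolds, hA0] at ih
      rw [hA0]
      gcongr
      exact (sumsetBound_mono (Submodule.finrank_mono hWle) _ _).trans ih
    _ ≤ _ := by
      rw [← card_union_of_disjoint hdisj]
      exact card_le_card hsub

variable [IsOrderedAddMonoid V] {A B : Finset V}

/-- A sum of two negative elements is smaller than both, so the elements of `A ∪ B` that are
not sums already span. -/
theorem span_union_le_span_sdiff_add (hA : ∀ x ∈ A, x < 0) (hB : ∀ x ∈ B, x < 0) :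
    Submodule.span 𝕜 ((A : Set V) ∪ B)
      ≤ Submodule.span 𝕜 (((A ∪ B) \ (A + B) : Finset V) : Set V) := by
  set M := Submodule.span 𝕜 (((A ∪ B) \ (A + B) : Finset V) : Set V)
  classical
  rw [Submodule.span_le, ← coe_union]
  by_contra hne
  have hne' : ((A ∪ B).filter (· ∉ M)).Nonempty := by
    obtain ⟨x, hx, hxM⟩ := Set.not_subset.1 hne
    exact ⟨x, mem_filter.2 ⟨hx, hxM⟩⟩
  obtain ⟨x, hx, hmax⟩ := exists_max_image _ id hne'
  obtain ⟨hxS, hxM⟩ := mem_filter.1 hx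
  have hmem : ∀ y ∈ A ∪ B, x < y → y ∈ M := fun y hy hxy => by
    by_contra hyM
    exact (hmax y (mem_filter.2 ⟨hy, hyM⟩)).not_gt hxy
  by_cases hxAB : x ∈ A + B
  · obtain ⟨a, ha, b, hb, rfl⟩ := mem_add.1 hxAB
    exact hxM (M.add_mem (hmem a (mem_union_left _ ha) (add_lt_of_neg_right a (hB b hb)))
      (hmem b (mem_union_right _ hb) (add_lt_of_neg_left b (hA a ha))))
  · exact hxM (Submodule.subset_span (mem_coe.2 (mem_sdiff.2 ⟨hxS, hxAB⟩)))

theorem card_insert_zero_add_insert_zero (hA : ∀ x ∈ A, x < 0) (hB : ∀ x ∈ B, x < 0) :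
    #(insert 0 A + insert 0 B) = #((A + B) ∪ (A ∪ B)) + 1 := by
  rw [← card_insert_of_notMem (a := (0 : V)) (s := (A + B) ∪ (A ∪ B))]
  · congr 1
    ext x
    simp only [insert_eq, union_add, add_union, mem_union, singleton_zero, zero_add, add_zero,
      mem_zero]
    tauto
  · simp only [mem_union, mem_add, not_or, not_exists, not_and]
    exact ⟨fun a ha b hb => (add_neg (hA a ha) (hB b hb)).ne,
      fun h => (hA 0 h).false, fun h => (hB 0 h).false⟩

variable [FiniteDimensional 𝕜 V]

theorem sumsetBound_le_card_insert_zero_add (hA : ∀ x ∈ A, x < 0) (hB : ∀ x ∈ B, x < 0)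
    (hA' : A.Nonempty) (hB' : B.Nonempty) (ih : SumsetBoundHolds 𝕜 A B)
    (ihA : SumsetBoundHolds 𝕜 (insert 0 A) B) (ihB : SumsetBoundHolds 𝕜 A (insert 0 B)) :
    sumsetBound (Module.finrank 𝕜 (Submodule.span 𝕜 ((A : Set V) ∪ B))) (#A + 1) (#B + 1)
      ≤ #(insert 0 A + insert 0 B) := by
  obtain ⟨a, ha⟩ := hA'
  obtain ⟨b, hb⟩ := hB'
  obtain ⟨W, hW⟩ : ∃ W, W = vectorSpan 𝕜 (A : Set V) ⊔ vectorSpan 𝕜 (B : Set V) := ⟨_, rfl⟩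
  have hAW : vectorSpan 𝕜 (A : Set V) ≤ W := hW ▸ le_sup_left
  have hBW : vectorSpan 𝕜 (B : Set V) ≤ W := hW ▸ le_sup_right
  have hspan := span_union_le_sup_sup hAW hBW ha hb
  have hK : 1 ≤ #A := card_pos.2 ⟨a, ha⟩
  have hL : 1 ≤ #B := card_pos.2 ⟨b, hb⟩
  by_cases haW : a ∈ W <;> by_cases hbW : b ∈ W
  · rw [sup_eq_left.2 (by simpa using haW : Submodule.span 𝕜 {a} ≤ W),
      sup_eq_left.2 (by simpa using hbW : Submodule.span 𝕜 {b} ≤ W)] at hspan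
    rw [card_insert_zero_add_insert_zero hA hB, ← union_sdiff_self_eq_union,
      card_union_of_disjoint disjoint_sdiff]
    have hle := (Submodule.finrank_mono (span_union_le_span_sdiff_add (𝕜 := 𝕜) hA hB)).trans
      (finrank_span_finset_le_card _)
    rw [SumsetBoundHolds, ← hW] at ih
    have h₁ := sumsetBound_mono (Submodule.finrank_mono hspan) #A #B
    have h₂ := sumsetBound_succ_succ_le
      (d := Module.finrank 𝕜 (Submodule.span 𝕜 ((A : Set V) ∪ B))) hK hL
    omega
  · exact sumsetBound_le_of_mem_of_notMem (fun h => (hA 0 h).false) ha hb ihA hW haW hbW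
  · rw [sumsetBound_comm, add_comm (insert 0 A), Set.union_comm]
    exact sumsetBound_le_of_mem_of_notMem (fun h => (hB 0 h).false) hb ha ihB.symm
      (hW.trans (sup_comm _ _)) hbW haW
  rw [SumsetBoundHolds, ← hW] at ih
  have hAmem : ∀ x ∈ A, x ∉ W := fun x hx => mt (mem_iff_of_vectorSpan_le hAW hx ha).1 haW
  have hBmem : ∀ x ∈ B, x ∉ W := fun x hx => mt (mem_iff_of_vectorSpan_le hBW hx hb).1 hbW
  have hdisjA : Disjoint (A + B) A := by
    rw [disjoint_left]
    intro x hx hxA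
    obtain ⟨y, hy, z, hz, rfl⟩ := mem_add.1 hx
    exact hBmem z hz (by simpa using hAW (vsub_mem_vectorSpan 𝕜 hxA hy))
  have hdisjB : Disjoint (A + B) B := by
    rw [disjoint_left]
    intro x hx hxB
    obtain ⟨y, hy, z, hz, rfl⟩ := mem_add.1 hx
    exact hAmem y hy (by simpa using hBW (vsub_mem_vectorSpan 𝕜 hxB hz))
  rw [card_insert_zero_add_insert_zero hA hB,
    card_union_of_disjoint (disjoint_union_right.2 ⟨hdisjA, hdisjB⟩)]
  by_cases hab : a - b ∈ W
  · have hdim : Module.finrank 𝕜 (Submodule.span 𝕜 ((A : Set V) ∪ B))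
        ≤ Module.finrank 𝕜 W + 1 := by
      have hbU : b ∈ W ⊔ Submodule.span 𝕜 {a} := by
        have := Submodule.sub_mem _
          (Submodule.mem_sup_right (S := W) (Submodule.mem_span_singleton_self a))
          (Submodule.mem_sup_left hab)
        simpa using this
      rw [sup_eq_left.2 (by simpa using hbU : Submodule.span 𝕜 {b} ≤ W ⊔ Submodule.span 𝕜 {a})]
        at hspan
      exact (Submodule.finrank_mono hspan).trans (finrank_sup_span_singleton_le W a)
    have h₁ := sumsetBound_mono hdim (#A + 1) (#B + 1)
    have h₂ := sumsetBound_add_one_succ_succ_le (d := Module.finrank 𝕜 W) hK hL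
    have h₃ := max_le (card_le_card (subset_union_left (s₁ := A) (s₂ := B)))
      (card_le_card (subset_union_right (s₁ := A) (s₂ := B)))
    omega
  · have hdim : Module.finrank 𝕜 (Submodule.span 𝕜 ((A : Set V) ∪ B))
        ≤ Module.finrank 𝕜 W + 2 :=
      (Submodule.finrank_mono hspan).trans <| (finrank_sup_span_singleton_le _ b).trans <|
        Nat.succ_le_succ (finrank_sup_span_singleton_le W a)
    have hdisj : Disjoint A B := by
      rw [disjoint_left]
      intro x hxA hxB
      have h₁ : x - b ∈ W := hBW (vsub_mem_vectorSpan 𝕜 hxB hb)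
      have h₂ : x - a ∈ W := hAW (vsub_mem_vectorSpan 𝕜 hxA ha)
      exact hab (by simpa using W.sub_mem h₁ h₂)
    rw [card_union_of_disjoint hdisj]
    have h₁ := sumsetBound_mono hdim (#A + 1) (#B + 1)
    have h₂ := sumsetBound_add_two_succ_succ_le (d := Module.finrank 𝕜 W) hK hL
    omega

theorem exists_vadd_eq_insert_zero (hA : A.Nonempty) :
    ∃ (v : V) (A' : Finset V), v +ᵥ A = insert 0 A' ∧ ∀ x ∈ A', x < 0 := by
  refine ⟨-A.max' hA, (-A.max' hA +ᵥ A).erase 0, ?_, ?_⟩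
  · refine (insert_erase (mem_vadd_finset.2 ⟨A.max' hA, A.max'_mem hA, ?_⟩)).symm
    simp
  · intro x hx
    obtain ⟨hx0, hx⟩ := mem_erase.1 hx
    obtain ⟨y, hy, rfl⟩ := mem_vadd_finset.1 hx
    refine lt_of_le_of_ne ?_ hx0
    simpa using A.le_max' y hy

theorem sumsetBoundHolds (A B : Finset V) (hA : A.Nonempty) (hB : B.Nonempty) :
    SumsetBoundHolds 𝕜 A B := by
  induction hN : #A + #B using Nat.strong_induction_on generalizing A B with
  | h N ih =>
  obtain ⟨v, A', hvA, hA'⟩ := exists_vadd_eq_insert_zero hA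
  obtain ⟨w, B', hwB, hB'⟩ := exists_vadd_eq_insert_zero hB
  have hcA : #A = #A' + 1 := by
    rw [← card_vadd_finset v A, hvA, card_insert_of_notMem fun h => (hA' 0 h).false]
  have hcB : #B = #B' + 1 := by
    rw [← card_vadd_finset w B, hwB, card_insert_of_notMem fun h => (hB' 0 h).false]
  rcases A'.eq_empty_or_nonempty with rfl | hneA
  · have := card_le_card_add_left (t := B) hA
    rw [card_empty, zero_add] at hcA
    rw [SumsetBoundHolds, sumsetBound, show min #A #B - 1 = 0 by omega, range_zero, sum_empty]
    omega
  rcases B'.eq_empty_or_nonempty with rfl | hneB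
  · have := card_le_card_add_right (s := A) hB
    rw [card_empty, zero_add] at hcB
    rw [SumsetBoundHolds, sumsetBound, show min #A #B - 1 = 0 by omega, range_zero, sum_empty]
    omega
  have hc0A : #(insert 0 A') = #A' + 1 := card_insert_of_notMem fun h => (hA' 0 h).false
  have hc0B : #(insert 0 B') = #B' + 1 := card_insert_of_notMem fun h => (hB' 0 h).false
  have key := sumsetBound_le_card_insert_zero_add (𝕜 := 𝕜) hA' hB' hneA hneB
    (ih _ (by omega) _ _ hneA hneB rfl)
    (ih _ (by omega) _ _ (insert_nonempty _ _) hneB rfl)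
    (ih _ (by omega) _ _ hneA (insert_nonempty _ _) rfl)
  have hle (v : V) (S S' : Finset V) (h : v +ᵥ S = insert 0 S') :
      vectorSpan 𝕜 (S : Set V) ≤ Submodule.span 𝕜 (S' : Set V) := by
    rw [← vectorSpan_vadd 𝕜 _ v, ← coe_vadd_finset, h, coe_insert,
      vectorSpan_eq_span_vsub_set_right 𝕜 (Set.mem_insert _ _)]
    simp
  have hcard : #(insert 0 A' + insert 0 B') = #(A + B) := by
    rw [← hvA, ← hwB, vadd_add_vadd_comm, card_vadd_finset]
  rw [SumsetBoundHolds, hcA, hcB, ← hcard]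
  refine (sumsetBound_mono (Submodule.finrank_mono ?_) _ _).trans key
  rw [Submodule.span_union]
  exact sup_le_sup (hle v A A' hvA) (hle w B B' hwB)

theorem sumsetBound_finrank_le_card_add {E : Type*} [AddCommGroup E] [Module 𝕜 E]
    [DecidableEq E] (e : E ≃ₗ[𝕜] V) {A B : Finset E} (hA : A.Nonempty) (hB : B.Nonempty)
    (hspan : affineSpan 𝕜 ((A + B : Finset E) : Set E) = ⊤) :
    sumsetBound (Module.finrank 𝕜 E) #A #B ≤ #(A + B) := by
  have hadd : A.image e + B.image e = (A + B).image e := (image_add e).symm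
  have htop : vectorSpan 𝕜 (A.image e : Set V) ⊔ vectorSpan 𝕜 (B.image e : Set V) = ⊤ := by
    rw [eq_top_iff]
    refine le_trans ?_ (vectorSpan_add_le_s4 _ _)
    have himage := e.toLinearMap.toAffineMap.map_vectorSpan
      (s := ((A + B : Finset E) : Set E))
    rw [← direction_affineSpan, hspan, AffineSubspace.direction_top] at himage
    rw [← coe_add, hadd, coe_image]
    refine le_trans ?_ himage.le
    simp
  have key := sumsetBoundHolds (𝕜 := 𝕜) (A.image e) (B.image e) (hA.image e) (hB.image e)
  rwa [SumsetBoundHolds, htop, hadd, finrank_top, card_image_of_injective _ e.injective,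
    card_image_of_injective _ e.injective, card_image_of_injective _ e.injective,
    ← e.finrank_eq] at key

end

/-- If `A, B ⊆ ℝⁿ` are finite, `K = |A| ≤ |B| = L`, the Minkowski sum `A + B` affinely
spans `ℝⁿ`, and `max {1, L-K} ≤ n ≤ L`, then `|A+B| ≥ (n+1)K - (n-L+K)(n-L+K+1)/2`. -/
theorem sumset_card_lower_bound_middle_dim (n : ℕ)
    (A B : Finset (Fin n → ℝ)) (hA : A.Nonempty) (hB : B.Nonempty)
    (hAB : A.card ≤ B.card)
    (hspan : affineSpan ℝ ((A + B : Finset (Fin n → ℝ)) : Set (Fin n → ℝ)) = ⊤)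
    (hn1 : max 1 ((B.card : ℤ) - A.card) ≤ (n : ℤ)) (hn2 : n ≤ B.card) :
    ((n : ℤ) + 1) * A.card - ((n : ℤ) - B.card + A.card) * ((n : ℤ) - B.card + A.card + 1) / 2
      ≤ ((A + B).card : ℤ) := by
  refine (le_sumsetBound hA.card_pos hAB (by omega) hn2).trans (Nat.cast_le.2 ?_)
  let e := toLexLinearEquiv ℝ (Fin n → ℝ)
  have := Module.Finite.equiv e
  simpa using sumsetBound_finrank_le_card_add e hA hB hspan
end

section
/- Let $K, L, n$ be integers with $2 \leq K \leq L$ and $1 \leq n \leq L - K$. Then there exist finite sets $A, B \subseteq \mathbb{R}^n$ with $|A| = K$, $|B| = L$, such that the affine span of $A+B$ is all of $\mathbb{R}^n$ and $|A+B| = L + n(K-1)$. -/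
open scoped Pointwise

/-- The `k`-th integer point on the `i`-th line parallel to the first coordinate axis: the line
with index `0` is the axis itself, the line with index `i ≠ 0` passes through the `i`-th standard
basis vector. -/
noncomputable def parallelLinePoint {m : ℕ} (p : Σ _ : Fin (m + 1), ℕ) : Fin (m + 1) → ℝ :=
  Pi.single 0 (p.2 : ℝ) + if p.1 = 0 then 0 else Pi.single p.1 1

theorem parallelLinePoint_injective {m : ℕ} :
    Function.Injective (parallelLinePoint (m := m)) := by
  rintro ⟨i, k⟩ ⟨j, l⟩ h
  have hkl : k = l := by
    have h0 := congrFun h 0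
    by_cases hi : i = 0 <;> by_cases hj : j = 0 <;>
      simpa [parallelLinePoint, hi, hj, Pi.single_apply, eq_comm] using h0
  subst hkl
  have h' := add_left_cancel h
  by_cases hi : i = 0 <;> by_cases hj : j = 0
  · rw [hi, hj]
  · have := congrFun h' j
    simp [hi, hj] at this
  · have := congrFun h' i
    simp [hi, hj] at this
  · have := congrFun h' i
    simp only [hi, hj, if_false, Pi.single_eq_same, Pi.single_apply] at this
    split_ifs at this with hij
    · rw [hij]
    · simp at this

theorem parallelLinePoint_zero_add {m : ℕ} (i : Fin (m + 1)) (a b : ℕ) :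
    parallelLinePoint ⟨0, a⟩ + parallelLinePoint ⟨i, b⟩ = parallelLinePoint ⟨i, a + b⟩ := by
  simp [parallelLinePoint, Pi.single_add, add_assoc]

theorem image_parallelLinePoint_add {m K : ℕ} (hK : 1 ≤ K) (c : Fin (m + 1) → ℕ)
    (hc : ∀ i, 1 ≤ c i) :
    (Finset.range K).image (fun a => parallelLinePoint (m := m) ⟨0, a⟩) +
        (Finset.univ.sigma fun i => Finset.range (c i)).image parallelLinePoint =
      (Finset.univ.sigma fun i => Finset.range (c i + (K - 1))).image parallelLinePoint := by
  ext x
  simp only [Finset.mem_add, Finset.mem_image, Finset.mem_range, Finset.mem_sigma,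
    Finset.mem_univ, true_and]
  constructor
  · rintro ⟨_, ⟨a, ha, rfl⟩, _, ⟨⟨i, b⟩, hb, rfl⟩, rfl⟩
    refine ⟨⟨i, a + b⟩, ?_, (parallelLinePoint_zero_add i a b).symm⟩
    dsimp only at hb ⊢
    omega
  · rintro ⟨⟨i, k⟩, hk, rfl⟩
    dsimp only at hk
    have := hc i
    refine ⟨_, ⟨min k (K - 1), by omega, rfl⟩, _, ⟨⟨i, k - min k (K - 1)⟩, ?_, rfl⟩, ?_⟩
    · dsimp only
      omega
    · rw [parallelLinePoint_zero_add]
      congr 2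
      omega

theorem affineSpan_image_parallelLinePoint {m : ℕ} (d : Fin (m + 1) → ℕ) (hd : ∀ i, 1 ≤ d i)
    (hd0 : 2 ≤ d 0) :
    affineSpan ℝ (((Finset.univ.sigma fun i => Finset.range (d i)).image parallelLinePoint :
      Finset (Fin (m + 1) → ℝ)) : Set (Fin (m + 1) → ℝ)) = ⊤ := by
  set S := (Finset.univ.sigma fun i => Finset.range (d i)).image parallelLinePoint with hS
  have mem : ∀ i k, k < d i → parallelLinePoint ⟨i, k⟩ ∈ (S : Set (Fin (m + 1) → ℝ)) := by
    intro i k h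
    exact Finset.mem_coe.2 (Finset.mem_image_of_mem _ (by simpa using h))
  have h0 : (0 : Fin (m + 1) → ℝ) ∈ (S : Set (Fin (m + 1) → ℝ)) := by
    simpa [parallelLinePoint] using mem 0 0 (hd 0)
  rw [AffineSubspace.affineSpan_eq_top_iff_vectorSpan_eq_top_of_nonempty ℝ _ _ ⟨0, h0⟩,
    eq_top_iff, ← (Pi.basisFun ℝ (Fin (m + 1))).span_eq, Submodule.span_le]
  rintro _ ⟨i, rfl⟩
  have hi : (Pi.single i 1 : Fin (m + 1) → ℝ) ∈ (S : Set (Fin (m + 1) → ℝ)) := by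
    by_cases h : i = 0
    · subst h
      simpa [parallelLinePoint] using mem 0 1 hd0
    · simpa [parallelLinePoint, h] using mem i 0 (hd i)
  simpa using vsub_mem_vectorSpan ℝ hi h0

/-- For `2 ≤ K ≤ L` and `1 ≤ n ≤ L - K`, the bound `|A+B| ≥ L + n(K-1)` is achieved:
there are finite `A, B ⊆ ℝⁿ` with `|A| = K`, `|B| = L`, whose Minkowski sum affinely
spans `ℝⁿ` and satisfies `|A+B| = L + n(K-1)`. -/
theorem sumset_bound_sharp_small_dim (K L n : ℕ) (hK : 2 ≤ K) (hKL : K ≤ L)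
    (hn1 : 1 ≤ n) (hn2 : (n : ℤ) ≤ (L : ℤ) - K) :
    ∃ A B : Finset (Fin n → ℝ), A.card = K ∧ B.card = L ∧
      affineSpan ℝ ((A + B : Finset (Fin n → ℝ)) : Set (Fin n → ℝ)) = ⊤ ∧
      (A + B).card = L + n * (K - 1) := by
  obtain ⟨m, rfl⟩ : ∃ m, n = m + 1 := ⟨n - 1, by omega⟩
  let c : Fin (m + 1) → ℕ := Fin.cons (L - m) fun _ => 1
  have hc : ∀ i, 1 ≤ c i := by
    intro i
    refine Fin.cases ?_ (fun j => ?_) i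
    · simp only [c, Fin.cons_zero]
      omega
    · simp [c]
  have hsum : ∑ i, c i = L := by
    simp only [c, Fin.sum_univ_succ, Fin.cons_zero, Fin.cons_succ, Finset.sum_const,
      Finset.card_univ, Fintype.card_fin, smul_eq_mul]
    omega
  refine ⟨(Finset.range K).image fun a => parallelLinePoint ⟨0, a⟩,
    (Finset.univ.sigma fun i => Finset.range (c i)).image parallelLinePoint, ?_, ?_, ?_, ?_⟩
  · rw [Finset.card_image_of_injective _ fun a b h => ?_, Finset.card_range]
    simpa using parallelLinePoint_injective h
  · simp [Finset.card_image_of_injective _ parallelLinePoint_injective, hsum]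
  · rw [image_parallelLinePoint_add (by omega) c hc]
    refine affineSpan_image_parallelLinePoint _ (fun i => (hc i).trans (Nat.le_add_right _ _)) ?_
    have := hc 0
    omega
  · rw [image_parallelLinePoint_add (by omega) c hc,
      Finset.card_image_of_injective _ parallelLinePoint_injective]
    simp [Finset.sum_add_distrib, hsum]
end

section
/- Let $K, L, n$ be integers with $3 \leq K \leq L$ and $1 \leq n \leq K + L - 2$, and let $A, B \subseteq \mathbb{R}^n$ be finite sets with $|A| = K$, $|B| = L$ such that the affine span of $A+B$ is all of $\mathbb{R}^n$. Then $(n+2) \cdot K L < (K + L + 2) \cdot |A+B|$. -/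
open scoped Pointwise

theorem add_min_notMem_add_erase {E G : Type*} [AddCommGroup E] [DecidableEq E]
    [AddCommGroup G] [LinearOrder G] [IsOrderedAddMonoid G]
    {A B : Finset E} {φ : E →+ G} (hφ : Function.Injective φ)
    {v w : E} (hvmin : ∀ a ∈ A, φ v ≤ φ a) (hwmin : ∀ b ∈ B, φ w ≤ φ b) :
    v + w ∉ A + B.erase w := by
  intro h
  obtain ⟨a, ha, b, hb, hab⟩ := Finset.mem_add.1 h
  obtain ⟨hbw, hb⟩ := Finset.mem_erase.1 hb
  have h1 := hvmin a ha
  have h2 := lt_of_le_of_ne (hwmin b hb) fun h => hbw (hφ h).symm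
  have h3 := congrArg φ hab
  rw [map_add, map_add] at h3
  exact absurd h3 (add_lt_add_of_le_of_lt h1 h2).ne'

/-- The dimension of `A + B`, for nonempty `A` and `B`. -/
noncomputable def sumDim {E : Type*} [AddCommGroup E] [Module ℝ E] (A B : Finset E) : ℕ :=
  Module.finrank ℝ ↥(vectorSpan ℝ (A : Set E) ⊔ vectorSpan ℝ (B : Set E))

section

variable {E : Type*} [AddCommGroup E] [Module ℝ E]

theorem sumDim_comm (A B : Finset E) : sumDim A B = sumDim B A := by
  rw [sumDim, sumDim, sup_comm]

theorem vectorSpan_le_of_sub_mem {s : Set E} {W : Submodule ℝ E} (p : E)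
    (h : ∀ x ∈ s, x - p ∈ W) : vectorSpan ℝ s ≤ W := by
  rw [vectorSpan_def, Submodule.span_le]
  rintro _ ⟨x, hx, y, hy, rfl⟩
  have := W.sub_mem (h x hx) (h y hy)
  simpa using this

theorem sub_mem_vectorSpan {s : Set E} {x y : E} (hx : x ∈ s) (hy : y ∈ s) :
    x - y ∈ vectorSpan ℝ s := vsub_mem_vectorSpan ℝ hx hy

variable [FiniteDimensional ℝ E] [DecidableEq E]

theorem sumDim_add_two_le {A B : Finset E} (hA : A.Nonempty) (hB : B.Nonempty) :
    sumDim A B + 2 ≤ A.card + B.card := by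
  have key : ∀ C : Finset E, C.Nonempty →
      Module.finrank ℝ (vectorSpan ℝ (C : Set E)) + 1 ≤ C.card := by
    intro C hC
    have hc := hC.card_pos
    have := finrank_vectorSpan_image_finset_le ℝ (id : E → E) C (n := C.card - 1) (by omega)
    rw [Finset.image_id] at this
    omega
  have h1 := key A hA
  have h2 := key B hB
  have h3 := Submodule.finrank_add_le_finrank_add_finrank
    (vectorSpan ℝ (A : Set E)) (vectorSpan ℝ (B : Set E))
  unfold sumDim
  omega

theorem sumDim_le_of_sub_mem {A B : Finset E} {v a : E} (ha : a ∈ A.erase v)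
    (h : v - a ∈ vectorSpan ℝ (A.erase v : Set E) ⊔ vectorSpan ℝ (B : Set E)) :
    sumDim A B ≤ sumDim (A.erase v) B := by
  refine Submodule.finrank_mono (sup_le (vectorSpan_le_of_sub_mem a fun x hx => ?_) le_sup_right)
  rcases eq_or_ne x v with rfl | hxv
  · exact h
  · exact Submodule.mem_sup_left
      (sub_mem_vectorSpan (Finset.mem_erase.2 ⟨hxv, hx⟩) ha)

theorem sumDim_le_erase_add_one {A : Finset E} (B : Finset E) {v : E}
    (hA : (A.erase v).Nonempty) : sumDim A B ≤ sumDim (A.erase v) B + 1 := by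
  obtain ⟨a, ha⟩ := hA
  set W := vectorSpan ℝ (A.erase v : Set E) ⊔ vectorSpan ℝ (B : Set E)
  have hle : vectorSpan ℝ (A : Set E) ⊔ vectorSpan ℝ (B : Set E) ≤ W ⊔ ℝ ∙ (v - a) := by
    refine sup_le (vectorSpan_le_of_sub_mem a fun x hx => ?_) (le_sup_right.trans le_sup_left)
    rcases eq_or_ne x v with rfl | hxv
    · exact Submodule.mem_sup_right (Submodule.mem_span_singleton_self _)
    · exact Submodule.mem_sup_left (Submodule.mem_sup_left
        (sub_mem_vectorSpan (Finset.mem_erase.2 ⟨hxv, hx⟩) ha))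
  have h1 := Submodule.finrank_mono hle
  have h2 := Submodule.finrank_add_le_finrank_add_finrank W (ℝ ∙ (v - a))
  have h3 : Module.finrank ℝ (ℝ ∙ (v - a)) ≤ 1 :=
    (finrank_span_le_card ({v - a} : Set E)).trans (by simp)
  have h4 : sumDim (A.erase v) B = Module.finrank ℝ W := rfl
  unfold sumDim at *
  omega

theorem sumDim_le_of_add_mem {A B : Finset E} {v b : E} (hb : b ∈ B)
    (h : v + b ∈ A.erase v + B) : sumDim A B ≤ sumDim (A.erase v) B := by
  obtain ⟨a, ha, b', hb', hab⟩ := Finset.mem_add.1 h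
  refine sumDim_le_of_sub_mem ha (Submodule.mem_sup_right ?_)
  have : v - a = b' - b := by
    rw [sub_eq_sub_iff_add_eq_add, ← hab, add_comm]
  rw [this]
  exact sub_mem_vectorSpan hb' hb

theorem card_add_of_sumDim_erase_lt {A B : Finset E} {v : E} (hv : v ∈ A)
    (h : sumDim (A.erase v) B < sumDim A B) :
    (A.erase v + B).card + B.card ≤ (A + B).card := by
  have hdisj : Disjoint (A.erase v + B) (B.image (v + ·)) := by
    rw [Finset.disjoint_right]
    intro x hx hx'
    obtain ⟨b, hb, rfl⟩ := Finset.mem_image.1 hx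
    exact absurd (sumDim_le_of_add_mem hb hx') (by omega)
  rw [← Finset.card_image_of_injective B (add_right_injective v),
    ← Finset.card_union_of_disjoint hdisj]
  refine Finset.card_le_card (Finset.union_subset
    (Finset.add_subset_add_right (Finset.erase_subset _ _)) fun x hx => ?_)
  obtain ⟨b, hb, rfl⟩ := Finset.mem_image.1 hx
  exact Finset.add_mem_add hv hb

section Order

variable {G : Type*} [AddCommGroup G] [LinearOrder G] [IsOrderedAddMonoid G]

/-- Removing the least elements of both `A` and `B` deletes at least `dim (A + B) + 1` sums:
the sums of the form `v + b` or `a + w` that are deleted span the whole space. -/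
theorem card_add_erase_erase_add_sumDim_lt {A B : Finset E} {φ : E →+ G}
    (hφ : Function.Injective φ) {v w : E} (hv : v ∈ A) (hw : w ∈ B)
    (hvmin : ∀ a ∈ A, φ v ≤ φ a) (hwmin : ∀ b ∈ B, φ w ≤ φ b) :
    (A.erase v + B.erase w).card + (sumDim A B + 1) ≤ (A + B).card := by
  classical
  set T := A.erase v + B.erase w
  set U := B.image (v + ·) ∪ A.image (· + w)
  have hvwT : v + w ∉ T := fun h =>
    add_min_notMem_add_erase hφ hvmin hwmin
      (Finset.add_subset_add_right (Finset.erase_subset _ _) h)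
  have hvwU : v + w ∈ U := Finset.mem_union_left _ (Finset.mem_image_of_mem _ hw)
  set C := U \ T
  set P := vectorSpan ℝ (C : Set E) with hP
  have hvwC : v + w ∈ C := Finset.mem_sdiff.2 ⟨hvwU, hvwT⟩
  have hUP : ∀ x ∈ U, x - (v + w) ∈ P := by
    by_contra! hcon
    obtain ⟨x₀, hx₀, hx₀P⟩ := hcon
    obtain ⟨x, hx, hxmin⟩ := Finset.exists_min_image (U.filter fun x => x - (v + w) ∉ P) φ
      ⟨x₀, Finset.mem_filter.2 ⟨hx₀, hx₀P⟩⟩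
    obtain ⟨hxU, hxP⟩ := Finset.mem_filter.1 hx
    have hxT : x ∈ T := by
      by_contra hxT
      exact hxP (sub_mem_vectorSpan (Finset.mem_sdiff.2 ⟨hxU, hxT⟩) hvwC)
    obtain ⟨a, ha, b, hb, rfl⟩ := Finset.mem_add.1 hxT
    obtain ⟨hav, ha⟩ := Finset.mem_erase.1 ha
    obtain ⟨hbw, hb⟩ := Finset.mem_erase.1 hb
    have hlta := lt_of_le_of_ne (hvmin a ha) fun h => hav (hφ h).symm
    have hltb := lt_of_le_of_ne (hwmin b hb) fun h => hbw (hφ h).symm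
    have h1 : v + b - (v + w) ∈ P := by
      by_contra h
      have := hxmin (v + b) (Finset.mem_filter.2
        ⟨Finset.mem_union_left _ (Finset.mem_image_of_mem _ hb), h⟩)
      rw [map_add, map_add] at this
      exact absurd this (not_le.2 (add_lt_add_left hlta _))
    have h2 : a + w - (v + w) ∈ P := by
      by_contra h
      have := hxmin (a + w) (Finset.mem_filter.2
        ⟨Finset.mem_union_right _ (Finset.mem_image_of_mem (· + w) ha), h⟩)
      rw [map_add, map_add] at this
      exact absurd this (not_le.2 (add_lt_add_right hltb _))
    refine hxP ?_
    have h3 := P.add_mem h1 h2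
    have h4 : v + b - (v + w) + (a + w - (v + w)) = a + b - (v + w) := by abel
    rwa [h4] at h3
  have hAB : vectorSpan ℝ (A : Set E) ⊔ vectorSpan ℝ (B : Set E) ≤ P := by
    refine sup_le (vectorSpan_le_of_sub_mem v fun a ha => ?_)
      (vectorSpan_le_of_sub_mem w fun b hb => ?_)
    · have := hUP (a + w) (Finset.mem_union_right _ (Finset.mem_image_of_mem (· + w) ha))
      rwa [add_sub_add_right_eq_sub] at this
    · have := hUP (v + b) (Finset.mem_union_left _ (Finset.mem_image_of_mem _ hb))
      rwa [add_sub_add_left_eq_sub] at this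
  have hdim : sumDim A B + 1 ≤ C.card := by
    have hc : 0 < C.card := Finset.card_pos.2 ⟨_, hvwC⟩
    have h1 := finrank_vectorSpan_image_finset_le ℝ (id : E → E) C (n := C.card - 1) (by omega)
    rw [Finset.image_id] at h1
    have h2 : sumDim A B ≤ Module.finrank ℝ P := Submodule.finrank_mono hAB
    rw [hP] at h2
    omega
  have hdisj : Disjoint T C := Finset.disjoint_sdiff
  calc T.card + (sumDim A B + 1) ≤ T.card + C.card := by omega
    _ = (T ∪ C).card := (Finset.card_union_of_disjoint hdisj).symm
    _ ≤ (A + B).card := by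
      refine Finset.card_le_card (Finset.union_subset
        (Finset.add_subset_add (Finset.erase_subset _ _) (Finset.erase_subset _ _))
        (Finset.sdiff_subset.trans (Finset.union_subset ?_ ?_)))
      · intro x hx
        obtain ⟨b, hb, rfl⟩ := Finset.mem_image.1 hx
        exact Finset.add_mem_add hv hb
      · intro x hx
        obtain ⟨a, ha, rfl⟩ := Finset.mem_image.1 hx
        exact Finset.add_mem_add ha hw

theorem card_add_erase_erase_add_card_le {A B : Finset E} {φ : E →+ G}
    (hφ : Function.Injective φ) {v w : E} (hv : v ∈ A) (hw : w ∈ B)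
    (hvmin : ∀ a ∈ A, φ v ≤ φ a) (hwmin : ∀ b ∈ B, φ w ≤ φ b)
    (h : sumDim (A.erase v) (B.erase w) < sumDim A (B.erase w)) :
    (A.erase v + B.erase w).card + B.card ≤ (A + B).card := by
  have h1 := card_add_of_sumDim_erase_lt hv h
  have h2 : (A + B.erase w).card < (A + B).card := by
    refine Finset.card_lt_card (Finset.ssubset_iff_of_subset
      (Finset.add_subset_add_left (Finset.erase_subset _ _)) |>.2
      ⟨v + w, Finset.add_mem_add hv hw, add_min_notMem_add_erase hφ hvmin hwmin⟩)
  rw [Finset.card_erase_of_mem hw] at h1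
  omega

end Order

end

section Arithmetic

variable {K L m N : ℤ}

theorem bound_of_dim_drop (hK : 0 ≤ K) (hL : 0 ≤ L) (hm : m ≤ K + 1 + L + 2)
    (h : (m - 1) * (K * L) < (K + L + 2) * N) :
    m * ((K + 1) * L) < (K + 1 + L + 2) * (N + L) := by
  have h1 : 0 ≤ L * ((K + 1 + L + 2 - m) * (L + 2)) :=
    mul_nonneg hL (mul_nonneg (by linarith) (by linarith))
  have h2 : 0 < (K + 1 + L + 2) * ((K + L + 2) * N - (m - 1) * (K * L)) :=
    mul_pos (by linarith) (by linarith)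
  have h3 : 0 < (K + L + 2) * ((K + 1 + L + 2) * (N + L) - m * ((K + 1) * L)) := by
    linarith
  linarith [(pos_iff_pos_of_mul_pos h3).1 (by linarith)]

theorem bound_of_erase_right (hK : 0 ≤ K) (hL : 0 ≤ L)
    (hm : m * (K * (K + 2)) ≤ (K + L + 3) * (K + L + 2))
    (h : m * (K * L) < (K + L + 2) * N) :
    m * (K * (L + 1)) < (K + (L + 1) + 2) * (N + 1) := by
  have h2 : 0 < (K + L + 3) * ((K + L + 2) * N - m * (K * L)) :=
    mul_pos (by linarith) (by linarith)
  have h3 : 0 < (K + L + 2) * ((K + (L + 1) + 2) * (N + 1) - m * (K * (L + 1))) := by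
    linarith
  linarith [(pos_iff_pos_of_mul_pos h3).1 (by linarith)]

theorem bound_of_erase_erase (hK : 0 ≤ K) (hL : 0 ≤ L)
    (hm : (K + L + 4) * (K + L + 2) ≤ m * (K + L + 4 + 2 * ((K + 1) * (L + 1))))
    (h : m * (K * L) < (K + L + 2) * N) :
    m * ((K + 1) * (L + 1)) < (K + 1 + (L + 1) + 2) * (N + (m - 1)) := by
  have h2 : 0 < (K + L + 4) * ((K + L + 2) * N - m * (K * L)) :=
    mul_pos (by linarith) (by linarith)
  have h3 : 0 < (K + L + 2) *
      ((K + 1 + (L + 1) + 2) * (N + (m - 1)) - m * ((K + 1) * (L + 1))) := by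
    linarith
  linarith [(pos_iff_pos_of_mul_pos h3).1 (by linarith)]

theorem bound_of_erase_erase_of_dim_drop {x : ℤ} (hK : 0 ≤ K) (hKL : K ≤ L)
    (hx : L + 1 ≤ x) (hmx : m - 1 ≤ x) (h : (m - 1) * (K * L) < (K + L + 2) * N) :
    m * ((K + 1) * (L + 1)) < (K + 1 + (L + 1) + 2) * (N + x) := by
  have h2 : 0 < (K + L + 4) * ((K + L + 2) * N - (m - 1) * (K * L)) :=
    mul_pos (by linarith) (by linarith)
  have h0 : 0 ≤ (L + 1) * (K + L + 4 + (K + 1) * (L - K)) :=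
    mul_nonneg (by linarith)
      (add_nonneg (by linarith) (mul_nonneg (by linarith) (by linarith)))
  have hL : 0 ≤ L := hK.trans hKL
  have h4 : 0 ≤ (K + L + 4) * (K + L + 2) * x + (K + L + 4) * ((m - 1) * (K * L))
      - (K + L + 2) * (m * ((K + 1) * (L + 1))) := by
    have hS : 0 ≤ (K + L + 4) * (K + L + 2) := mul_nonneg (by linarith) (by linarith)
    rcases le_total m (L + 2) with hm | hm
    · have h5 : 0 ≤ (L + 2 - m) *
          ((K + 1) ^ 2 + (L + 1) ^ 2 + K + L) :=
        mul_nonneg (by linarith) (by positivity)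
      have h6 := mul_le_mul_of_nonneg_left hx hS
      linarith
    · have h5 : 0 ≤ (m - (L + 2)) * (K + L + 4 + 2 * ((K + 1) * (L + 1))) :=
        mul_nonneg (by linarith) (by positivity)
      have h6 := mul_le_mul_of_nonneg_left hmx hS
      linarith
  have h3 : 0 < (K + L + 2) *
      ((K + 1 + (L + 1) + 2) * (N + x) - m * ((K + 1) * (L + 1))) := by
    linarith
  linarith [(pos_iff_pos_of_mul_pos h3).1 (by linarith)]

theorem erase_right_or_erase_erase (hK : 0 ≤ K) (hKL : K ≤ L) (hm : 0 ≤ m) :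
    m * ((K + 1) * (K + 1 + 2)) ≤ (K + 1 + L + 3) * (K + 1 + L + 2) ∨
      (K + L + 4) * (K + L + 2) ≤ m * (K + L + 4 + 2 * ((K + 1) * (L + 1))) := by
  by_contra! hcon
  obtain ⟨h1, h2⟩ := hcon
  have hL : 0 ≤ L := hK.trans hKL
  have h3 : (K + 1) * (K + 1 + 2) ≤ K + L + 4 + 2 * ((K + 1) * (L + 1)) := by
    nlinarith
  have h4 := mul_le_mul_of_nonneg_left h3 hm
  linarith

end Arithmetic

theorem sumDim_add_two_mul_lt {E G : Type*} [AddCommGroup E] [Module ℝ E]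
    [FiniteDimensional ℝ E] [DecidableEq E] [AddCommGroup G] [LinearOrder G]
    [IsOrderedAddMonoid G] {φ : E →+ G} (hφ : Function.Injective φ) {A B : Finset E}
    (hA : A.Nonempty) (hB : B.Nonempty) :
    (sumDim A B + 2) * (A.card * B.card) < (A.card + B.card + 2) * (A + B).card := by
  induction hs : A.card + B.card using Nat.strong_induction_on generalizing A B with
  | _ s ih =>
  subst hs
  wlog hAB : A.card ≤ B.card generalizing A B
  · have := this hB hA (fun s hs A' B' => ih s (by omega)) (by omega)
    rwa [sumDim_comm, mul_comm B.card, add_comm B.card, add_comm B] at this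
  have hdim := sumDim_add_two_le hA hB
  rcases Nat.lt_or_ge 1 A.card with hA1 | hA1
  swap
  · have hA1 : A.card = 1 := le_antisymm hA1 hA.card_pos
    obtain ⟨a, rfl⟩ := Finset.card_eq_one.1 hA1
    have hBpos := hB.card_pos
    rw [Finset.singleton_add, Finset.card_vadd_finset, Finset.card_singleton, one_mul]
    rw [Finset.card_singleton] at hdim
    exact Nat.mul_lt_mul_of_pos_right (by omega) hBpos
  have hne : ∀ {C : Finset E} {x : E}, 1 < C.card → x ∈ C → (C.erase x).Nonempty := by
    intro C x hC hx
    rw [← Finset.card_pos, Finset.card_erase_of_mem hx]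
    omega
  have hB1 : 1 < B.card := hA1.trans_le hAB
  obtain ⟨v, hv, hvmin⟩ := Finset.exists_min_image A φ hA
  obtain ⟨w, hw, hwmin⟩ := Finset.exists_min_image B φ hB
  have hcA := Finset.card_erase_add_one hv
  have hcB := Finset.card_erase_add_one hw
  have hA' := hne hA1 hv
  have hB' := hne hB1 hw
  have hdA := sumDim_le_erase_add_one B hA'
  have hdB := sumDim_le_erase_add_one A hB'
  have hdAB := sumDim_le_erase_add_one (B.erase w) hA'
  rw [sumDim_comm B A, sumDim_comm _ A] at hdB
  have ihA := ih _ (by omega) hA' hB rfl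
  have ihB := ih _ (by omega) hA hB' rfl
  have ihAB := ih _ (by omega) hA' hB' rfl
  have hpA := hA'.card_pos
  have hpB := hB'.card_pos
  have mono : ∀ {d d' k l N : ℕ}, d ≤ d' → (d' + 2) * (k * l) < (k + l + 2) * N →
      ((d : ℤ) + 2) * (k * l) < (k + l + 2) * N := fun {d d' k l N} hd h => by
    have := lt_of_le_of_lt (Nat.mul_le_mul_right (k * l) (Nat.add_le_add_right hd 2)) h
    exact_mod_cast this
  have of_le : ∀ x : ℤ, x ≤ (A + B).card →
      (sumDim A B + 2 : ℤ) * (A.card * B.card) < (A.card + B.card + 2) * x →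
      (sumDim A B + 2) * (A.card * B.card) < (A.card + B.card + 2) * (A + B).card := by
    intro x hx h
    have := h.trans_le (mul_le_mul_of_nonneg_left hx (by positivity))
    exact_mod_cast this
  have hwmem := add_min_notMem_add_erase hφ hvmin hwmin
  rcases lt_or_ge (sumDim (A.erase v) B) (sumDim A B) with h1 | h1
  · have hN := card_add_of_sumDim_erase_lt hv h1
    refine of_le ((A.erase v + B).card + B.card) (by exact_mod_cast hN) ?_
    have hd : ((sumDim A B : ℤ) + 2 - 1) ≤ sumDim (A.erase v) B + 2 := by omega
    have := bound_of_dim_drop (K := (A.erase v).card) (L := B.card) (m := sumDim A B + 2)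
      (N := (A.erase v + B).card) (by positivity) (by positivity) (by omega)
      (lt_of_le_of_lt (mul_le_mul_of_nonneg_right hd (by positivity)) (by exact_mod_cast ihA))
    rw [← hcA]
    push_cast
    exact this
  rcases lt_or_ge (sumDim A (B.erase w)) (sumDim A B) with h2 | h2
  · have hN := card_add_of_sumDim_erase_lt (B := A) hw
      (by rwa [sumDim_comm, sumDim_comm B])
    rw [add_comm _ A, add_comm B] at hN
    refine of_le ((A + B.erase w).card + A.card) (by exact_mod_cast hN) ?_
    have hd : ((sumDim A B : ℤ) + 2 - 1) ≤ sumDim A (B.erase w) + 2 := by omega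
    have := bound_of_dim_drop (K := (B.erase w).card) (L := A.card) (m := sumDim A B + 2)
      (N := (A + B.erase w).card) (by positivity) (by positivity) (by omega)
      (lt_of_le_of_lt (mul_le_mul_of_nonneg_right hd (by positivity))
        (by rw [mul_comm ((B.erase w).card : ℤ), add_comm ((B.erase w).card : ℤ)]
            exact_mod_cast ihB))
    rw [← hcB]
    push_cast
    linarith
  rcases erase_right_or_erase_erase (K := (A.erase v).card) (L := (B.erase w).card)
    (m := sumDim A B + 2) (by positivity) (by omega) (by positivity) with h3 | h3
  · have hN : (A + B.erase w).card < (A + B).card :=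
      Finset.card_lt_card (Finset.ssubset_iff_of_subset
        (Finset.add_subset_add_left (Finset.erase_subset _ _)) |>.2
        ⟨v + w, Finset.add_mem_add hv hw, hwmem⟩)
    refine of_le ((A + B.erase w).card + 1) (by exact_mod_cast hN) ?_
    have hcA' : ((A.erase v).card : ℤ) + 1 = A.card := by exact_mod_cast hcA
    rw [hcA'] at h3
    have := bound_of_erase_right (by positivity) (by positivity) h3 (mono h2 ihB)
    rw [← hcB]
    push_cast
    exact this
  have hN := card_add_erase_erase_add_sumDim_lt hφ hv hw hvmin hwmin
  rcases lt_or_ge (sumDim (A.erase v) (B.erase w)) (sumDim A B) with h4 | h4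
  · have hN' := card_add_erase_erase_add_card_le hφ hv hw hvmin hwmin (by omega)
    refine of_le ((A.erase v + B.erase w).card +
      ((A + B).card - (A.erase v + B.erase w).card)) (by omega) ?_
    have hd : ((sumDim A B : ℤ) + 2 - 1) ≤ sumDim (A.erase v) (B.erase w) + 2 := by omega
    have := bound_of_erase_erase_of_dim_drop (K := (A.erase v).card) (L := (B.erase w).card)
      (m := sumDim A B + 2) (N := (A.erase v + B.erase w).card)
      (x := (A + B).card - (A.erase v + B.erase w).card)
      (by positivity) (by omega) (by omega) (by omega)
      (lt_of_le_of_lt (mul_le_mul_of_nonneg_right hd (by positivity)) (by exact_mod_cast ihAB))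
    rw [← hcA, ← hcB]
    push_cast
    exact this
  · refine of_le ((A.erase v + B.erase w).card + ((sumDim A B + 2) - 1)) (by omega) ?_
    have := bound_of_erase_erase (by positivity) (by positivity) h3 (mono h4 ihAB)
    rw [← hcA, ← hcB]
    push_cast
    exact this

/-- `ρ(K,L) < (K+L+2)/(KL)` for `3 ≤ K ≤ L`: if `A, B ⊆ ℝⁿ` are finite with
`|A| = K`, `|B| = L`, `1 ≤ n ≤ K + L - 2`, and `A + B` affinely spans `ℝⁿ`, then
`(n+2)·KL < (K+L+2)·|A+B|`. -/
theorem rho_lt_bound (K L n : ℕ) (hK : 3 ≤ K) (hKL : K ≤ L)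
    (hn1 : 1 ≤ n) (hn2 : n ≤ K + L - 2)
    (A B : Finset (Fin n → ℝ)) (hA : A.card = K) (hB : B.card = L)
    (hspan : affineSpan ℝ ((A + B : Finset (Fin n → ℝ)) : Set (Fin n → ℝ)) = ⊤) :
    (n + 2) * (K * L) < (K + L + 2) * (A + B).card := by
  subst hA hB
  have hAne : A.Nonempty := Finset.card_pos.1 (by omega)
  have hBne : B.Nonempty := Finset.card_pos.1 (by omega)
  have hle : n ≤ sumDim A B := by
    obtain ⟨a, ha⟩ := hAne
    obtain ⟨b, hb⟩ := hBne
    have h1 : vectorSpan ℝ ((A + B : Finset (Fin n → ℝ)) : Set (Fin n → ℝ)) = ⊤ := by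
      rw [← direction_affineSpan, hspan, AffineSubspace.direction_top]
    have h2 : vectorSpan ℝ ((A + B : Finset (Fin n → ℝ)) : Set (Fin n → ℝ)) ≤
        vectorSpan ℝ (A : Set (Fin n → ℝ)) ⊔ vectorSpan ℝ (B : Set (Fin n → ℝ)) := by
      refine vectorSpan_le_of_sub_mem (a + b) fun x hx => ?_
      obtain ⟨a', ha', b', hb', rfl⟩ := Finset.mem_add.1 (Finset.mem_coe.1 hx)
      rw [add_sub_add_comm]
      exact Submodule.add_mem_sup (sub_mem_vectorSpan ha' ha) (sub_mem_vectorSpan hb' hb)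
    rw [h1, top_le_iff] at h2
    rw [sumDim, h2, finrank_top, Module.finrank_fin_fun]
  have hφ : Function.Injective
      (AddMonoidHom.mk' (toLex : (Fin n → ℝ) → Lex (Fin n → ℝ)) fun _ _ => rfl) :=
    toLex.injective
  refine lt_of_le_of_lt ?_ (sumDim_add_two_mul_lt hφ hAne hBne)
  gcongr
end

section
/- Let $L \geq 2$ and $1 \leq n \leq L$, and let $A, B \subseteq \mathbb{R}^n$ be finite sets with $|A| = 2$, $|B| = L$ such that the affine span of $A+B$ is all of $\mathbb{R}^n$. Then $(n+2) \cdot 2L \leq (L+2) \cdot |A+B|$. -/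
open scoped Pointwise

/-- In a torsion-free group, moving from a point of a finite set `B` along `d ≠ 0` one eventually
leaves `B`. -/
theorem Finset.exists_add_nsmul_mem_and_add_notMem {V : Type*} [AddCommGroup V]
    [IsAddTorsionFree V] {B : Finset V} {b d : V} (hb : b ∈ B) (hd : d ≠ 0) :
    ∃ k : ℕ, b + k • d ∈ B ∧ b + k • d + d ∉ B := by
  by_contra! h
  have hmem : ∀ k : ℕ, b + k • d ∈ B := by
    intro k
    induction k with
    | zero => simpa using hb
    | succ k ih => simpa [succ_nsmul, add_assoc] using h k ih
  have hinj : Function.Injective fun k : ℕ => b + k • d :=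
    fun k l hkl => Nat.cast_injective (smul_left_injective ℤ hd
      (by simpa only [natCast_zsmul] using add_left_cancel hkl))
  exact Set.infinite_of_injective_forall_mem hinj hmem B.finite_toSet

/-- If `B` is nonempty, `d ≠ 0`, and `{a, a + d} + B` affinely spans `V`, then at least `dim V`
points of `B` leave `B` when translated by `d`. -/
theorem finrank_le_card_filter_add_notMem {V : Type*} [AddCommGroup V] [Module ℝ V]
    [DecidableEq V] (a d : V) (hd : d ≠ 0) {B : Finset V} (hB : B.Nonempty)
    (hspan : affineSpan ℝ ((({a, a + d} : Finset V) + B : Finset V) : Set V) = ⊤) :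
    Module.finrank ℝ V ≤ (B.filter fun b => b + d ∉ B).card := by
  have : IsAddTorsionFree V := .of_isTorsionFree ℝ V
  set T := B.filter fun b => b + d ∉ B
  have hex : ∀ b ∈ B, ∃ t ∈ T, ∃ k : ℕ, b + k • d = t := fun b hb => by
    obtain ⟨k, h1, h2⟩ := Finset.exists_add_nsmul_mem_and_add_notMem hb hd
    exact ⟨_, Finset.mem_filter.2 ⟨h1, h2⟩, k, rfl⟩
  obtain ⟨b₀, hb₀⟩ := hB
  obtain ⟨t₀, ht₀, -⟩ := hex b₀ hb₀
  set S : Finset V := insert d ((T.erase t₀).image fun t => t - t₀) with hS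
  set W : Submodule ℝ V := Submodule.span ℝ (S : Set V)
  have hdW : d ∈ W := Submodule.subset_span (by simp [hS])
  have htW : ∀ t ∈ T, t - t₀ ∈ W := by
    intro t ht
    by_cases h : t = t₀
    · simp [h]
    · exact Submodule.subset_span (Finset.mem_coe.2 (Finset.mem_insert_of_mem
        (Finset.mem_image_of_mem _ (Finset.mem_erase.2 ⟨h, ht⟩))))
  have hbW : ∀ b ∈ B, b - t₀ ∈ W := by
    intro b hb
    obtain ⟨t, ht, k, hk⟩ := hex b hb
    have : b - t₀ = (t - t₀) - k • d := by rw [← hk]; abel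
    rw [this]
    exact W.sub_mem (htW t ht) (W.smul_of_tower_mem k hdW)
  have hle : affineSpan ℝ ((({a, a + d} : Finset V) + B : Finset V) : Set V) ≤
      AffineSubspace.mk' (a + t₀) W := by
    rw [affineSpan_le]
    intro x hx
    obtain ⟨y, hy, b, hb, rfl⟩ := Finset.mem_add.1 (Finset.mem_coe.1 hx)
    rw [SetLike.mem_coe, AffineSubspace.mem_mk', vsub_eq_sub]
    rcases Finset.mem_insert.1 hy with rfl | hy
    · simpa using hbW b hb
    · rw [Finset.mem_singleton.1 hy, show a + d + b - (a + t₀) = d + (b - t₀) by abel]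
      exact W.add_mem hdW (hbW b hb)
  have hWtop : W = ⊤ := by
    rw [hspan, top_le_iff] at hle
    simpa using congrArg AffineSubspace.direction hle
  calc Module.finrank ℝ V = Module.finrank ℝ W := by rw [hWtop, finrank_top]
    _ ≤ S.card := finrank_span_finset_le_card S
    _ ≤ (T.erase t₀).card + 1 :=
      (Finset.card_insert_le _ _).trans (Nat.add_le_add_right Finset.card_image_le 1)
    _ = T.card := Finset.card_erase_add_one ht₀

/-- The sumset `{a, a + d} + B` contains a translate of `B` and, disjoint from it, a translate of
the points that leave `B` when translated by `d`. -/
theorem card_add_card_filter_le_card_pair_add {V : Type*} [AddCommGroup V] [DecidableEq V]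
    (a d : V) (B : Finset V) :
    B.card + (B.filter fun b => b + d ∉ B).card ≤ (({a, a + d} : Finset V) + B).card := by
  have hdisj : Disjoint (B.image (a + ·))
      ((B.filter fun b => b + d ∉ B).image (a + d + ·)) := by
    simp only [Finset.disjoint_left, Finset.mem_image, Finset.mem_filter]
    rintro _ ⟨b, hb, rfl⟩ ⟨t, ⟨-, ht⟩, h⟩
    have : t + d = b := add_left_cancel (a := a) (by rw [← h]; abel)
    exact ht (this ▸ hb)
  rw [← Finset.card_image_of_injective B (add_right_injective a),
    ← Finset.card_image_of_injective (B.filter _) (add_right_injective (a + d)),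
    ← Finset.card_union_of_disjoint hdisj]
  refine Finset.card_le_card (Finset.union_subset ?_ ?_)
  · exact Finset.image_subset_iff.2 fun b hb => Finset.add_mem_add (by simp) hb
  · exact Finset.image_subset_iff.2 fun b hb =>
      Finset.add_mem_add (by simp) (Finset.mem_filter.1 hb).1

/-- `ρ(2,L) = (L+2)/(2L)`: if `A, B ⊆ ℝⁿ` are finite with `|A| = 2`, `|B| = L ≥ 2`,
`1 ≤ n ≤ L`, and `A + B` affinely spans `ℝⁿ`, then `(n+2)·2L ≤ (L+2)·|A+B|`. -/
theorem rho_two_bound (L n : ℕ) (hL : 2 ≤ L) (hn1 : 1 ≤ n) (hn2 : n ≤ L)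
    (A B : Finset (Fin n → ℝ)) (hA : A.card = 2) (hB : B.card = L)
    (hspan : affineSpan ℝ ((A + B : Finset (Fin n → ℝ)) : Set (Fin n → ℝ)) = ⊤) :
    (n + 2) * (2 * L) ≤ (L + 2) * (A + B).card := by
  obtain ⟨a, a', hne, rfl⟩ := Finset.card_eq_two.1 hA
  obtain ⟨d, rfl⟩ : ∃ d, a' = a + d := ⟨a' - a, by abel⟩
  have hd : d ≠ 0 := by
    rintro rfl
    simp at hne
  have hdim := finrank_le_card_filter_add_notMem a d hd
    (Finset.card_pos.1 (by omega : 0 < B.card)) (by convert hspan)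
  rw [Module.finrank_fin_fun] at hdim
  have hcard : L + n ≤ (({a, a + d} : Finset (Fin n → ℝ)) + B).card := by
    have := card_add_card_filter_le_card_pair_add a d B
    omega
  calc (n + 2) * (2 * L) ≤ (L + 2) * (L + n) := by
        zify at hL hn2 ⊢
        nlinarith [mul_nonneg (sub_nonneg.2 hL) (sub_nonneg.2 hn2)]
    _ ≤ _ := Nat.mul_le_mul_left _ hcard
end

section
/- Let $2 \leq k \leq l$, let $E = (a, b)$ be a rectangle with $a : \mathrm{Fin}\,k \to \mathbb{N}$ and $b : \mathrm{Fin}\,l \to \mathbb{N}$ injective, and let $N \geq 1$. Then the number of pairs $(x, y) \in C(E)$ with all coordinates of $x$ and $y$ lying in $\{0, 1, \ldots, N-1\}$ is at most $N^{n(E)}$. -/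
/-- For a rectangle `E = (a, b)`, the linear subspace `T_E` of `ℝᵏ × ℝˡ` consisting of all
`(x, y)` with `x_r + y_s = x_u + y_v` whenever `a_r + b_s = a_u + b_v`. -/
def rectSubspace (k l : ℕ) (a : Fin k → ℕ) (b : Fin l → ℕ) :
    Submodule ℝ ((Fin k → ℝ) × (Fin l → ℝ)) where
  carrier := {p | ∀ (r u : Fin k) (s v : Fin l),
    a r + b s = a u + b v → p.1 r + p.2 s = p.1 u + p.2 v}
  add_mem' := by
    intro x y hx hy r u s v h
    have h1 := hx r u s v h
    have h2 := hy r u s v h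
    simp only [Prod.fst_add, Prod.snd_add, Pi.add_apply]
    linarith
  zero_mem' := by intro r u s v h; simp
  smul_mem' := by
    intro c x hx r u s v h
    have h1 := hx r u s v h
    simp only [Prod.smul_fst, Prod.smul_snd, Pi.smul_apply, smul_eq_mul]
    linear_combination c * h1

/-- `n(E)`: the dimension of the subspace `T_E`. -/
noncomputable def rectDim (k l : ℕ) (a : Fin k → ℕ) (b : Fin l → ℕ) : ℕ :=
  Module.finrank ℝ (rectSubspace k l a b)

/-- `C(E)`: the equivalence class of the rectangle `E = (a, b)`, i.e. the set of
rectangles `(x, y)` satisfying exactly the same additive coincidences as `(a, b)`. -/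
def rectClass (k l : ℕ) (a : Fin k → ℕ) (b : Fin l → ℕ) :
    Set ((Fin k → ℕ) × (Fin l → ℕ)) :=
  {p | Function.Injective p.1 ∧ Function.Injective p.2 ∧
    ∀ (r u : Fin k) (s v : Fin l),
      (p.1 r + p.2 s = p.1 u + p.2 v ↔ a r + b s = a u + b v)}

/-- A point-separating family of linear functionals on a finite-dimensional space has a
separating subfamily with at most as many members as the dimension of the space. -/
theorem exists_separating_subfamily {K V ι : Type*} [Field K] [AddCommGroup V] [Module K V]
    [FiniteDimensional K V] [Finite ι] (φ : ι → Module.Dual K V)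
    (hφ : ∀ v, (∀ i, φ i v = 0) → v = 0) :
    ∃ s : Finset ι, s.card ≤ Module.finrank K V ∧ ∀ v, (∀ i ∈ s, φ i v = 0) → v = 0 := by
  classical
  obtain ⟨κ, f, hf, hspan, hli⟩ := exists_linearIndependent' K φ
  have : Finite κ := Finite.of_injective f hf
  have := Fintype.ofFinite κ
  refine ⟨Finset.univ.image f, ?_, fun v hv ↦ hφ v fun i ↦ ?_⟩
  · rw [Finset.card_image_of_injective _ hf, Finset.card_univ, ← Subspace.dual_finrank_eq]
    exact hli.fintype_card_le_finrank
  · have hle : Submodule.span K (Set.range (φ ∘ f)) ≤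
        LinearMap.ker (Module.Dual.eval K V v) := by
      rw [Submodule.span_le]
      rintro _ ⟨j, rfl⟩
      exact hv (f j) (Finset.mem_image_of_mem f (Finset.mem_univ j))
    exact hle (hspan ▸ Submodule.subset_span ⟨i, rfl⟩)

/-- The coordinate functionals on the subspace `T_E`. -/
def rectCoord (k l : ℕ) (a : Fin k → ℕ) (b : Fin l → ℕ) :
    Fin k ⊕ Fin l → Module.Dual ℝ (rectSubspace k l a b)
  | .inl i => LinearMap.proj i ∘ₗ LinearMap.fst ℝ _ _ ∘ₗ (rectSubspace k l a b).subtype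
  | .inr j => LinearMap.proj j ∘ₗ LinearMap.snd ℝ _ _ ∘ₗ (rectSubspace k l a b).subtype

theorem eq_zero_of_rectCoord_eq_zero {k l : ℕ} {a : Fin k → ℕ} {b : Fin l → ℕ}
    (v : rectSubspace k l a b) (hv : ∀ i, rectCoord k l a b i v = 0) : v = 0 :=
  Subtype.ext (Prod.ext (funext fun i ↦ hv (.inl i)) (funext fun j ↦ hv (.inr j)))

theorem cast_mem_rectSubspace {k l : ℕ} {a : Fin k → ℕ} {b : Fin l → ℕ}
    {p : (Fin k → ℕ) × (Fin l → ℕ)} (hp : p ∈ rectClass k l a b) :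
    ((fun i ↦ (p.1 i : ℝ), fun j ↦ (p.2 j : ℝ)) : (Fin k → ℝ) × (Fin l → ℝ)) ∈
      rectSubspace k l a b := by
  intro r u s v h
  dsimp only
  exact_mod_cast (hp.2.2 r u s v).2 h

/-- Lemma 1: the number of rectangles in the class `C(E)` with all coordinates in
`{0, …, N-1}` is at most `N^{n(E)}`. -/
theorem rectClass_bounded_card_le (k l : ℕ) (hk : 2 ≤ k) (hkl : k ≤ l)
    (a : Fin k → ℕ) (b : Fin l → ℕ)
    (ha : Function.Injective a) (hb : Function.Injective b) (N : ℕ) (hN : 1 ≤ N) :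
    {p ∈ rectClass k l a b | (∀ i, p.1 i < N) ∧ (∀ j, p.2 j < N)}.ncard
      ≤ N ^ rectDim k l a b := by
  obtain ⟨s, hs, hsep⟩ :=
    exists_separating_subfamily (rectCoord k l a b) eq_zero_of_rectCoord_eq_zero
  let g (p : {p ∈ rectClass k l a b | (∀ i, p.1 i < N) ∧ (∀ j, p.2 j < N)}) (i : s) : Fin N :=
    ⟨Sum.elim p.1.1 p.1.2 i, by rcases i with ⟨i | j, _⟩; exacts [p.2.2.1 i, p.2.2.2 j]⟩
  have hg : Function.Injective g := by
    rintro ⟨p, hp⟩ ⟨q, hq⟩ hpq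
    have hzero := hsep (⟨_, cast_mem_rectSubspace hp.1⟩ - ⟨_, cast_mem_rectSubspace hq.1⟩)
      fun i hi ↦ by
        have hi' : Sum.elim p.1 p.2 i = Sum.elim q.1 q.2 i :=
          congrArg Fin.val (congrFun hpq ⟨i, hi⟩)
        rw [map_sub, sub_eq_zero]
        rcases i with i | j <;> exact congrArg (Nat.cast (R := ℝ)) hi'
    have heq := Subtype.ext_iff.1 (sub_eq_zero.1 hzero)
    refine Subtype.ext (Prod.ext (funext fun i ↦ ?_) (funext fun j ↦ ?_))
    · exact Nat.cast_injective (R := ℝ) (congrFun (congrArg Prod.fst heq) i)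
    · exact Nat.cast_injective (R := ℝ) (congrFun (congrArg Prod.snd heq) j)
  calc _ ≤ Nat.card (s → Fin N) := Nat.card_le_card_of_injective g hg
    _ = N ^ s.card := by simp
    _ ≤ N ^ rectDim k l a b := Nat.pow_le_pow_right hN hs
end

section
/- Let $2 \leq k \leq l$ and $n \geq 1$. Then the collection of distinct sets $C(E)$, as $E$ ranges over all rectangles with $n(E) = n$, has cardinality at most $\binom{k^2 l^2}{k + l - n}$. -/
/-- The functional `(x, y) ↦ x_r + y_s - (x_u + y_v)` attached to the index `((r, u), (s, v))`. -/
def rectFunctional (k l : ℕ) (i : (Fin k × Fin k) × (Fin l × Fin l)) :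
    Module.Dual ℝ ((Fin k → ℝ) × (Fin l → ℝ)) :=
  ((LinearMap.proj i.1.1 : (Fin k → ℝ) →ₗ[ℝ] ℝ) - LinearMap.proj i.1.2).coprod
    ((LinearMap.proj i.2.1 : (Fin l → ℝ) →ₗ[ℝ] ℝ) - LinearMap.proj i.2.2)

theorem rectFunctional_apply_eq_zero {k l : ℕ} {i : (Fin k × Fin k) × (Fin l × Fin l)}
    {p : (Fin k → ℝ) × (Fin l → ℝ)} :
    rectFunctional k l i p = 0 ↔ p.1 i.1.1 + p.2 i.2.1 = p.1 i.1.2 + p.2 i.2.2 := by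
  simp only [rectFunctional, LinearMap.coprod_apply, LinearMap.sub_apply, LinearMap.proj_apply]
  constructor <;> intro h <;> linarith

/-- The indices of the additive coincidences of the rectangle `(a, b)`. -/
def rectCoincidences {k l : ℕ} (a : Fin k → ℕ) (b : Fin l → ℕ) :
    Set ((Fin k × Fin k) × (Fin l × Fin l)) :=
  {i | a i.1.1 + b i.2.1 = a i.1.2 + b i.2.2}

theorem rectSubspace_eq_dualCoannihilator {k l : ℕ} (a : Fin k → ℕ) (b : Fin l → ℕ) :
    rectSubspace k l a b =
      (Submodule.span ℝ (rectFunctional k l '' rectCoincidences a b)).dualCoannihilator := by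
  ext p
  rw [← SetLike.mem_coe (p := Submodule.dualCoannihilator _),
    Submodule.coe_dualCoannihilator_span]
  simp only [Set.mem_ofPred_eq, Set.forall_mem_image, rectFunctional_apply_eq_zero]
  exact ⟨fun h i hi => h _ _ _ _ hi, fun h r u s v e => h (x := ((r, u), (s, v))) e⟩

theorem finrank_span_rectCoincidences {k l : ℕ} (a : Fin k → ℕ) (b : Fin l → ℕ) :
    Module.finrank ℝ (Submodule.span ℝ (rectFunctional k l '' rectCoincidences a b)) =
      k + l - rectDim k l a b := by
  have h := Subspace.finrank_add_finrank_dualCoannihilator_eq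
    (Submodule.span ℝ (rectFunctional k l '' rectCoincidences a b))
  rw [← rectSubspace_eq_dualCoannihilator, Module.finrank_prod, Module.finrank_fin_fun,
    Module.finrank_fin_fun] at h
  unfold rectDim
  omega

theorem rectFunctional_mem_span_iff {k l : ℕ} {a : Fin k → ℕ} {b : Fin l → ℕ}
    {i : (Fin k × Fin k) × (Fin l × Fin l)} :
    rectFunctional k l i ∈ Submodule.span ℝ (rectFunctional k l '' rectCoincidences a b) ↔
      i ∈ rectCoincidences a b := by
  refine ⟨fun h => ?_, fun h => Submodule.subset_span (Set.mem_image_of_mem _ h)⟩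
  have hmem : ((fun r => (a r : ℝ), fun s => (b s : ℝ)) : (Fin k → ℝ) × (Fin l → ℝ)) ∈
      rectSubspace k l a b := fun r u s v e => by
    dsimp only
    exact_mod_cast e
  rw [rectSubspace_eq_dualCoannihilator, Submodule.mem_dualCoannihilator] at hmem
  have h0 := rectFunctional_apply_eq_zero.mp (hmem _ h)
  dsimp only at h0
  exact_mod_cast h0

/-- The rectangles whose coincidences are the indices of the functionals in the span of those
indexed by `B`. -/
def rectClassOfIndices (k l : ℕ) (B : Finset ((Fin k × Fin k) × (Fin l × Fin l))) :
    Set ((Fin k → ℕ) × (Fin l → ℕ)) :=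
  {p | Function.Injective p.1 ∧ Function.Injective p.2 ∧
    ∀ (r u : Fin k) (s v : Fin l), (p.1 r + p.2 s = p.1 u + p.2 v ↔
      rectFunctional k l ((r, u), (s, v)) ∈ Submodule.span ℝ (rectFunctional k l '' B))}

theorem exists_rectClass_eq_rectClassOfIndices {k l : ℕ} (a : Fin k → ℕ) (b : Fin l → ℕ) :
    ∃ B : Finset ((Fin k × Fin k) × (Fin l × Fin l)),
      B.card = k + l - rectDim k l a b ∧ rectClassOfIndices k l B = rectClass k l a b := by
  obtain ⟨B, hBZ, -, hspan, hB⟩ := exists_linearIndepOn_extension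
    (linearIndepOn_empty ℝ (rectFunctional k l)) (Set.empty_subset (rectCoincidences a b))
  have hspan_eq : Submodule.span ℝ (rectFunctional k l '' B) =
      Submodule.span ℝ (rectFunctional k l '' rectCoincidences a b) :=
    le_antisymm (Submodule.span_mono (Set.image_mono hBZ)) (Submodule.span_le.mpr hspan)
  lift B to Finset ((Fin k × Fin k) × (Fin l × Fin l)) using B.toFinite
  refine ⟨B, ?_, ?_⟩
  · have hcard := finrank_span_eq_card hB
    rw [← finrank_span_rectCoincidences, ← hspan_eq, Set.image_eq_range]
    simpa using hcard.symm
  · simp only [rectClassOfIndices, hspan_eq, rectFunctional_mem_span_iff]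
    rfl

/-- Lemma 2: the number of distinct classes `C(E)` over rectangles `E` with `n(E) = n`
is at most `binom(k²l², k+l-n)`. -/
theorem rectClass_count_le (k l n : ℕ) (hk : 2 ≤ k) (hkl : k ≤ l) (hn : 1 ≤ n) :
    {S : Set ((Fin k → ℕ) × (Fin l → ℕ)) | ∃ (a : Fin k → ℕ) (b : Fin l → ℕ),
        Function.Injective a ∧ Function.Injective b ∧
        rectDim k l a b = n ∧ S = rectClass k l a b}.ncard
      ≤ Nat.choose (k ^ 2 * l ^ 2) (k + l - n) := by
  calc
    _ ≤ (rectClassOfIndices k l '' (Finset.univ.powersetCard (k + l - n) :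
          Finset (Finset ((Fin k × Fin k) × (Fin l × Fin l))))).ncard := by
      refine Set.ncard_le_ncard ?_ (Set.toFinite _)
      rintro S ⟨a, b, -, -, rfl, rfl⟩
      obtain ⟨B, hcard, hB⟩ := exists_rectClass_eq_rectClassOfIndices a b
      exact ⟨B, by simp [hcard], hB⟩
    _ ≤ _ := Set.ncard_image_le (Set.toFinite _)
    _ = _ := by
      rw [Set.ncard_coe_finset, Finset.card_powersetCard]
      simp [pow_two]
end

section
/- Let $2 \leq k \leq l$ and let $E = (a, b)$ be a rectangle with $a : \mathrm{Fin}\,k \to \mathbb{N}$ and $b : \mathrm{Fin}\,l \to \mathbb{N}$ injective, and set $n = n(E)$. Then $n \geq 2$, and there exist finite sets $A, B \subseteq \mathbb{R}^{n-2}$ with $0 \in A$, $0 \in B$, $|A| = k$, $|B| = l$, such that $|A+B| = m(E)$ and the affine span of $A+B$ is all of $\mathbb{R}^{n-2}$. -/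
open scoped Pointwise

/-- The elements of `rectSubspace k l a b` whose coordinates `i` and `j` vanish. -/
def rectBasedSubspace (k l : ℕ) (a : Fin k → ℕ) (b : Fin l → ℕ) (i : Fin k) (j : Fin l) :
    Submodule ℝ ((Fin k → ℝ) × (Fin l → ℝ)) :=
  rectSubspace k l a b ⊓ LinearMap.ker ((LinearMap.proj i).prodMap (LinearMap.proj j) :
    (Fin k → ℝ) × (Fin l → ℝ) →ₗ[ℝ] ℝ × ℝ)

theorem mem_rectBasedSubspace {k l : ℕ} {a : Fin k → ℕ} {b : Fin l → ℕ} {i : Fin k} {j : Fin l}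
    {p : (Fin k → ℝ) × (Fin l → ℝ)} :
    p ∈ rectBasedSubspace k l a b i j ↔ p ∈ rectSubspace k l a b ∧ p.1 i = 0 ∧ p.2 j = 0 := by
  simp [rectBasedSubspace]

theorem finrank_rectBasedSubspace_add_two {k l : ℕ} (a : Fin k → ℕ) (b : Fin l → ℕ)
    (i : Fin k) (j : Fin l) :
    Module.finrank ℝ (rectBasedSubspace k l a b i j) + 2 = rectDim k l a b := by
  let φ : (Fin k → ℝ) × (Fin l → ℝ) →ₗ[ℝ] ℝ × ℝ := (LinearMap.proj i).prodMap (LinearMap.proj j)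
  have hsurj : LinearMap.range (φ ∘ₗ (rectSubspace k l a b).subtype) = ⊤ := by
    rw [LinearMap.range_eq_top]
    rintro ⟨c, d⟩
    exact ⟨⟨(fun _ => c, fun _ => d), fun _ _ _ _ _ => rfl⟩, rfl⟩
  have h := LinearMap.finrank_range_add_finrank_ker (φ ∘ₗ (rectSubspace k l a b).subtype)
  rw [hsurj, finrank_top, Module.finrank_prod, Module.finrank_self, LinearMap.ker_comp,
    ← Submodule.finrank_map_subtype_eq, Submodule.map_comap_subtype] at h
  rw [rectDim, ← h, rectBasedSubspace, add_comm]

/-- The `r`-th coordinate of the first component, as a functional on `rectBasedSubspace`. -/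
def rectFstCoord {k l : ℕ} (a : Fin k → ℕ) (b : Fin l → ℕ) (i : Fin k) (j : Fin l) (r : Fin k) :
    Module.Dual ℝ (rectBasedSubspace k l a b i j) where
  toFun p := p.1.1 r
  map_add' _ _ := rfl
  map_smul' _ _ := rfl

/-- The `s`-th coordinate of the second component, as a functional on `rectBasedSubspace`. -/
def rectSndCoord {k l : ℕ} (a : Fin k → ℕ) (b : Fin l → ℕ) (i : Fin k) (j : Fin l) (s : Fin l) :
    Module.Dual ℝ (rectBasedSubspace k l a b i j) where
  toFun p := p.1.2 s
  map_add' _ _ := rfl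
  map_smul' _ _ := rfl

theorem rectFstCoord_self {k l : ℕ} (a : Fin k → ℕ) (b : Fin l → ℕ) (i : Fin k) (j : Fin l) :
    rectFstCoord a b i j i = 0 :=
  LinearMap.ext fun p => (mem_rectBasedSubspace.1 p.2).2.1

theorem rectSndCoord_self {k l : ℕ} (a : Fin k → ℕ) (b : Fin l → ℕ) (i : Fin k) (j : Fin l) :
    rectSndCoord a b i j j = 0 :=
  LinearMap.ext fun p => (mem_rectBasedSubspace.1 p.2).2.2

theorem rectFstCoord_add_rectSndCoord_eq_iff {k l : ℕ} (a : Fin k → ℕ) (b : Fin l → ℕ)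
    (i r u : Fin k) (j s v : Fin l) :
    rectFstCoord a b i j r + rectSndCoord a b i j s =
      rectFstCoord a b i j u + rectSndCoord a b i j v ↔ a r + b s = a u + b v := by
  refine ⟨fun h => ?_, fun h => LinearMap.ext fun p => (mem_rectBasedSubspace.1 p.2).1 r u s v h⟩
  let p : (Fin k → ℝ) × (Fin l → ℝ) := (fun t => a t - a i, fun t => b t - b j)
  have hp : p ∈ rectBasedSubspace k l a b i j := by
    refine mem_rectBasedSubspace.2 ⟨fun r u s v h => ?_, sub_self _, sub_self _⟩
    have h' : (a r + b s : ℝ) = a u + b v := by exact_mod_cast h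
    simp only [p]
    linarith
  have h' : (a r - a i : ℝ) + (b s - b j) = (a u - a i) + (b v - b j) :=
    LinearMap.congr_fun h ⟨p, hp⟩
  have h'' : (a r + b s : ℝ) = a u + b v := by linarith
  exact_mod_cast h''

theorem rectFstCoord_injective {k l : ℕ} {a : Fin k → ℕ} (b : Fin l → ℕ)
    (ha : Function.Injective a) (i : Fin k) (j : Fin l) :
    Function.Injective (rectFstCoord a b i j) := fun r u h =>
  ha (add_right_cancel ((rectFstCoord_add_rectSndCoord_eq_iff a b i r u j j j).1 (by rw [h])))

theorem rectSndCoord_injective {k l : ℕ} (a : Fin k → ℕ) {b : Fin l → ℕ}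
    (hb : Function.Injective b) (i : Fin k) (j : Fin l) :
    Function.Injective (rectSndCoord a b i j) := fun s v h =>
  hb (add_left_cancel ((rectFstCoord_add_rectSndCoord_eq_iff a b i i i j s v).1 (by rw [h])))

theorem span_rectFstCoord_union_rectSndCoord {k l : ℕ} (a : Fin k → ℕ) (b : Fin l → ℕ)
    (i : Fin k) (j : Fin l) :
    Submodule.span ℝ (Set.range (rectFstCoord a b i j) ∪ Set.range (rectSndCoord a b i j)) =
      ⊤ := by
  refine Submodule.span_eq_top_of_ne_zero (R := ℝ) fun p hp => ?_
  contrapose! hp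
  refine Subtype.ext (Prod.ext (funext fun r => ?_) (funext fun s => ?_))
  · exact hp _ (Or.inl ⟨r, rfl⟩)
  · exact hp _ (Or.inr ⟨s, rfl⟩)

theorem Finset.card_image_eq_card_image_of_eq_iff {α β γ : Type*} [DecidableEq β] [DecidableEq γ]
    {f : α → β} {g : α → γ} (s : Finset α) (h : ∀ x y, f x = f y ↔ g x = g y) :
    (s.image f).card = (s.image g).card := by
  choose i hi using fun c (hc : c ∈ s.image f) => Finset.mem_image.1 hc
  refine Finset.card_bij (fun c hc => g (i c hc)) (fun c hc => Finset.mem_image_of_mem g (hi c hc).1) ?_ ?_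
  · intro c hc d hd hcd
    rw [← (hi c hc).2, ← (hi d hd).2, h, hcd]
  · intro d hd
    obtain ⟨x, hx, rfl⟩ := Finset.mem_image.1 hd
    have hfx := Finset.mem_image_of_mem f hx
    exact ⟨f x, hfx, (h _ _).1 (hi _ hfx).2⟩

theorem affineSpan_eq_top_of_zero_mem_of_span_eq_top {V : Type*} [AddCommGroup V] [Module ℝ V]
    {s : Set V} (h0 : (0 : V) ∈ s) (hs : Submodule.span ℝ s = ⊤) : affineSpan ℝ s = ⊤ := by
  rw [← Set.insert_eq_of_mem h0]
  refine SetLike.coe_injective ?_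
  rw [affineSpan_insert_zero, hs]
  rfl

/-- Lemma 3: for a rectangle `E = (a, b)` with `n = n(E)`, one has `n ≥ 2` and there exist
finite sets `A, B ⊆ ℝ^{n-2}` containing `0`, with `|A| = k`, `|B| = l`, such that
`|A+B| = m(E)` and the affine span of `A + B` is all of `ℝ^{n-2}`. -/
theorem rect_sumset_realization (k l : ℕ) (hk : 2 ≤ k) (hkl : k ≤ l)
    (a : Fin k → ℕ) (b : Fin l → ℕ)
    (ha : Function.Injective a) (hb : Function.Injective b) :
    2 ≤ rectDim k l a b ∧
    ∃ A B : Finset (Fin (rectDim k l a b - 2) → ℝ),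
      (0 : Fin (rectDim k l a b - 2) → ℝ) ∈ A ∧ (0 : Fin (rectDim k l a b - 2) → ℝ) ∈ B ∧
      A.card = k ∧ B.card = l ∧
      (A + B).card = (Finset.univ.image (fun p : Fin k × Fin l => a p.1 + b p.2)).card ∧
      affineSpan ℝ ((A + B : Finset (Fin (rectDim k l a b - 2) → ℝ)) :
        Set (Fin (rectDim k l a b - 2) → ℝ)) = ⊤ := by
  let i : Fin k := ⟨0, by omega⟩
  let j : Fin l := ⟨0, by omega⟩
  have hdim := finrank_rectBasedSubspace_add_two a b i j
  refine ⟨by omega, ?_⟩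
  let e : Module.Dual ℝ (rectBasedSubspace k l a b i j) ≃ₗ[ℝ] (Fin (rectDim k l a b - 2) → ℝ) :=
    LinearEquiv.ofFinrankEq _ _ (by
      have hdual : Module.finrank ℝ (Module.Dual ℝ (rectBasedSubspace k l a b i j)) =
          Module.finrank ℝ (rectBasedSubspace k l a b i j) := Subspace.dual_finrank_eq
      rw [Module.finrank_fin_fun]
      omega)
  let f := fun r => e (rectFstCoord a b i j r)
  let g := fun s => e (rectSndCoord a b i j s)
  have hf : f i = 0 := by simp only [f, rectFstCoord_self, map_zero]
  have hg : g j = 0 := by simp only [g, rectSndCoord_self, map_zero]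
  have hfA : 0 ∈ Finset.univ.image f := Finset.mem_image.2 ⟨i, Finset.mem_univ _, hf⟩
  have hgB : 0 ∈ Finset.univ.image g := Finset.mem_image.2 ⟨j, Finset.mem_univ _, hg⟩
  have hsum : Finset.univ.image f + Finset.univ.image g =
      Finset.univ.image (fun p : Fin k × Fin l => f p.1 + g p.2) := by
    ext x
    simp [Finset.mem_add]
  have hiff (p q : Fin k × Fin l) :
      f p.1 + g p.2 = f q.1 + g q.2 ↔ a p.1 + b p.2 = a q.1 + b q.2 := by
    simp only [f, g, ← map_add, e.injective.eq_iff, rectFstCoord_add_rectSndCoord_eq_iff]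
  refine ⟨Finset.univ.image f, Finset.univ.image g, hfA, hgB, ?_, ?_, ?_, ?_⟩
  · exact (Finset.card_image_of_injective _
      (e.injective.comp (rectFstCoord_injective b ha i j))).trans (Finset.card_fin _)
  · exact (Finset.card_image_of_injective _
      (e.injective.comp (rectSndCoord_injective a hb i j))).trans (Finset.card_fin _)
  · rw [hsum]
    exact Finset.card_image_eq_card_image_of_eq_iff _ hiff
  · refine affineSpan_eq_top_of_zero_mem_of_span_eq_top ?_ (top_unique ?_)
    · exact_mod_cast Finset.mem_add.2 ⟨0, hfA, 0, hgB, add_zero 0⟩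
    · have htop := congrArg (Submodule.map e.toLinearMap)
        (span_rectFstCoord_union_rectSndCoord a b i j)
      rw [Submodule.map_top, LinearEquiv.range, Submodule.map_span] at htop
      rw [← htop]
      refine Submodule.span_mono ?_
      rintro _ ⟨_, ⟨r, rfl⟩ | ⟨s, rfl⟩, rfl⟩
      · exact_mod_cast Finset.mem_add.2
          ⟨f r, Finset.mem_image_of_mem f (Finset.mem_univ r), 0, hgB, add_zero _⟩
      · exact_mod_cast Finset.mem_add.2
          ⟨0, hfA, g s, Finset.mem_image_of_mem g (Finset.mem_univ s), zero_add _⟩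
end

section
/- Let $N \geq 1$, $k, l \geq 1$, and let $c : \mathbb{Z}/2N\mathbb{Z} \to \{0,1\}$ satisfy $c_j = 0$ for all $j$ with $N \leq j < 2N$ (representatives in $\{0, \ldots, 2N-1\}$). Define the circulant $2N \times 2N$ Boolean matrix $\Gamma$ by $\Gamma_{i,j} = c_{(i+j) \bmod 2N}$. Then $\Gamma$ contains an all-ones $k \times l$ submatrix (i.e., there exist injective $a : \mathrm{Fin}\,k \to \mathbb{Z}/2N\mathbb{Z}$ and $b : \mathrm{Fin}\,l \to \mathbb{Z}/2N\mathbb{Z}$ with $\Gamma_{a_i, b_j} = 1$ for all $i, j$) if and only if there exist such injective $a$ and $b$ whose values all have representatives in $\{0, \ldots, N-1\}$. -/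
/-- If `Γ` is the circulant `2N × 2N` Boolean matrix `Γ_{i,j} = c_{(i+j) mod 2N}` whose
defining row `c` vanishes on `{N, …, 2N-1}`, then `Γ` contains an all-ones `k × l`
submatrix iff it contains one whose row and column indices all lie in `{0, …, N-1}`
(i.e. in the upper left `N × N` submatrix). -/
theorem circulant_allones_submatrix_shift (N k l : ℕ) (hN : 1 ≤ N) (hk : 1 ≤ k) (hl : 1 ≤ l)
    (c : ZMod (2 * N) → Bool) (hc : ∀ j : ZMod (2 * N), N ≤ j.val → c j = false) :
    (∃ (a : Fin k → ZMod (2 * N)) (b : Fin l → ZMod (2 * N)),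
        Function.Injective a ∧ Function.Injective b ∧
        ∀ i j, c (a i + b j) = true) ↔
    (∃ (a : Fin k → ZMod (2 * N)) (b : Fin l → ZMod (2 * N)),
        Function.Injective a ∧ Function.Injective b ∧
        (∀ i, (a i).val < N) ∧ (∀ j, (b j).val < N) ∧
        ∀ i j, c (a i + b j) = true) := by
  refine ⟨?_, fun ⟨a, b, ha, hb, _, _, h⟩ => ⟨a, b, ha, hb, h⟩⟩
  rintro ⟨a, b, ha, hb, h⟩
  have : NeZero (2 * N) := ⟨by omega⟩
  have : Nonempty (Fin l) := ⟨⟨0, hl⟩⟩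
  have sum_lt : ∀ i j, (a i + b j).val < N := by
    intro i j
    by_contra! hle
    simpa [h i j] using hc _ hle
  -- Translate by the column whose sum with a fixed row has the smallest representative.
  let r : Fin k := ⟨0, hk⟩
  obtain ⟨m, hm⟩ := Finite.exists_min fun j => (a r + b j).val
  refine ⟨fun i => a i + b m, fun j => b j - b m, fun x y hxy => ha (add_right_cancel hxy),
    fun x y hxy => hb (sub_left_injective hxy), fun i => sum_lt i m, fun j => ?_, fun i j => ?_⟩
  · have hval := ZMod.val_sub (hm j)
    rw [add_sub_add_left_eq_sub] at hval
    have := sum_lt r j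
    dsimp only
    omega
  · simpa using h i j
end
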